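/- arXiv:2105.00386 — 3 statements merged into one kernel-verified Lean document; each statement's English description precedes it below -/
import Mathlib

section
/- Let K be a field of characteristic zero and let δ = id − φ be a linear K-𝓔-derivation of the polynomial ring K[x1,x2] (so φ is a K-algebra endomorphism with each φ(x_i) a homogeneous linear form). Then the image of δ is a Mathieu-Zhao subspace of K[x1,x2]. -/
/-- A `K`-subspace `M` of a commutative `K`-algebra `R` is a Mathieu-Zhao subspace if
for all `a, b ∈ R`, whenever `a ^ m ∈ M` for all positive integers `m`,
then `b * a ^ m ∈ M` for all sufficiently large `m`. -/
def IsMZSubspace {K R : Type*} [CommRing K] [CommRing R] [Algebra K R]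
    (M : Submodule K R) : Prop :=
  ∀ a b : R, (∀ m : ℕ, 0 < m → a ^ m ∈ M) →
    ∃ N : ℕ, ∀ m : ℕ, N ≤ m → b * a ^ m ∈ M

open PowerSeries in
/-- Uniqueness of the solution of `Y' = Y q` with given constant coefficient. -/
lemma PowerSeries.eq_of_derivative_eq_mul {R : Type*} [CommRing R] [Algebra ℚ R] {q Y Z : R⟦X⟧}
    (h : constantCoeff Y = constantCoeff Z) (hY : derivative R Y = Y * q)
    (hZ : derivative R Z = Z * q) : Y = Z := by
  ext n
  induction n using Nat.strong_induction_on with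
  | _ n ih =>
    cases n with
    | zero => simpa using h
    | succ n =>
      have h1 := congrArg (coeff n) hY
      have h2 := congrArg (coeff n) hZ
      rw [coeff_derivative, coeff_mul] at h1 h2
      have h3 : coeff (n + 1) Y * ((n : R) + 1) = coeff (n + 1) Z * ((n : R) + 1) := by
        rw [h1, h2]
        refine Finset.sum_congr rfl fun x hx ↦ ?_
        rw [ih x.1 (by have := Finset.HasAntidiagonal.mem_antidiagonal.1 hx; omega)]
      have hu : IsUnit ((n : R) + 1) := by
        have : ((n : R) + 1) = algebraMap ℚ R (n + 1) := by simp
        rw [this]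
        exact (IsUnit.mk0 _ (by positivity)).map _
      exact hu.mul_right_cancel h3

open PowerSeries in
/-- Existence of the solution of `Y' = Y q` with constant coefficient `1`; its other coefficients
stay in any multiplicatively closed subspace containing the coefficients of `q`. -/
lemma PowerSeries.exists_derivative_eq_mul {R : Type*} [CommRing R] [Algebra ℚ R]
    (I : Submodule ℚ R) (hI : ∀ a ∈ I, ∀ b ∈ I, a * b ∈ I) (q : R⟦X⟧) (hq : ∀ m, coeff m q ∈ I) :
    ∃ Y : R⟦X⟧, constantCoeff Y = 1 ∧ derivative R Y = Y * q ∧ ∀ m, coeff (m + 1) Y ∈ I := by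
  let y : ℕ → R := fun n ↦ Nat.strongRec (motive := fun _ ↦ R) (fun n ih ↦
    match n, ih with
    | 0, _ => 1
    | n + 1, ih => ((n : ℚ) + 1)⁻¹ • ∑ i : Fin (n + 1), ih i i.2 * coeff (n - i) q) n
  have y0 : y 0 = 1 := by simp only [y]; rw [Nat.strongRec]
  have ys (n : ℕ) : y (n + 1) =
      ((n : ℚ) + 1)⁻¹ • ∑ i ∈ Finset.range (n + 1), y i * coeff (n - i) q := by
    rw [Finset.sum_range]
    simp only [y]
    rw [Nat.strongRec]
  refine ⟨mk y, by simp [y0, ← coeff_zero_eq_constantCoeff_apply], ?_, fun m ↦ ?_⟩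
  · ext n
    rw [coeff_derivative, coeff_mul, coeff_mk, ys, Finset.Nat.sum_antidiagonal_eq_sum_range_succ_mk]
    have : ((n : R) + 1) = algebraMap ℚ R (n + 1) := by simp
    rw [this, mul_comm, ← Algebra.smul_def, smul_smul, mul_inv_cancel₀ (by positivity), one_smul]
    simp
  · rw [coeff_mk]
    induction m using Nat.strong_induction_on with
    | _ m ih =>
      rw [ys]
      refine I.smul_mem _ (I.sum_mem fun i hi ↦ ?_)
      cases i with
      | zero => simpa [y0] using hq _
      | succ i => exact hI _ (ih i (by simp at hi; omega)) _ (hq _)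

open PowerSeries in
/-- If `H' = H (n + p)`, then `H` factors as a product of solutions for `n` and for `p`. -/
lemma PowerSeries.exists_wienerHopf {R : Type*} [CommRing R] [Algebra ℚ R]
    (I J : Submodule ℚ R) (hI : ∀ a ∈ I, ∀ b ∈ I, a * b ∈ I) (hJ : ∀ a ∈ J, ∀ b ∈ J, a * b ∈ J)
    (H n p : R⟦X⟧) (hn : ∀ m, coeff m n ∈ I) (hp : ∀ m, coeff m p ∈ J)
    (H0 : constantCoeff H = 1) (hH : derivative R H = H * (n + p)) :
    ∃ A B A' B' : R⟦X⟧, A * B = H ∧ A = H * B' ∧ B = H * A' ∧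
      constantCoeff A = 1 ∧ constantCoeff B = 1 ∧ constantCoeff A' = 1 ∧ constantCoeff B' = 1 ∧
      (∀ m, coeff (m + 1) A ∈ I) ∧ (∀ m, coeff (m + 1) B ∈ J) ∧
      (∀ m, coeff (m + 1) A' ∈ I) ∧ (∀ m, coeff (m + 1) B' ∈ J) := by
  obtain ⟨A, A0, dA, hA⟩ := exists_derivative_eq_mul I hI n hn
  obtain ⟨B, B0, dB, hB⟩ := exists_derivative_eq_mul J hJ p hp
  obtain ⟨A', A0', dA', hA'⟩ := exists_derivative_eq_mul I hI (-n)
    fun m ↦ by rw [map_neg]; exact I.neg_mem (hn m)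
  obtain ⟨B', B0', dB', hB'⟩ := exists_derivative_eq_mul J hJ (-p)
    fun m ↦ by rw [map_neg]; exact J.neg_mem (hp m)
  refine ⟨A, B, A', B', ?_, ?_, ?_, A0, B0, A0', B0', hA, hB, hA', hB'⟩
  · refine eq_of_derivative_eq_mul (q := n + p) (by simp [A0, B0, H0]) ?_ hH
    rw [Derivation.leibniz, dA, dB]; simp only [smul_eq_mul]; ring
  · refine eq_of_derivative_eq_mul (q := n) (by simp [A0, B0', H0]) dA ?_
    rw [Derivation.leibniz, hH, dB']; simp only [smul_eq_mul]; ring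
  · refine eq_of_derivative_eq_mul (q := p) (by simp [B0, A0', H0]) dB ?_
    rw [Derivation.leibniz, hH, dA']; simp only [smul_eq_mul]; ring

open PowerSeries in
/-- The logarithmic derivative of `∏ (1 - c r X)`. -/
lemma PowerSeries.derivative_prod_one_sub {R ι : Type*} [CommRing R] (s : Finset ι) (c : ι → R) :
    derivative R (∏ r ∈ s, (1 - C (c r) * X)) =
      (∏ r ∈ s, (1 - C (c r) * X)) * mk fun m ↦ -∑ r ∈ s, c r ^ (m + 1) := by
  classical
  induction s using Finset.induction with
  | empty => simp; ext; simp
  | insert a s ha ih =>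
    have h1 : (1 - C (c a) * X : R⟦X⟧) * mk (fun m ↦ -c a ^ (m + 1)) = - C (c a) := by
      ext m
      rw [sub_mul, one_mul, mul_assoc]
      cases m with
      | zero => simp
      | succ m => simp [coeff_succ_X_mul, pow_succ]; ring
    have h2 : (mk fun m ↦ -∑ r ∈ insert a s, c r ^ (m + 1)) =
        mk (fun m ↦ -c a ^ (m + 1)) + mk fun m ↦ -∑ r ∈ s, c r ^ (m + 1) := by
      ext m
      simp [Finset.sum_insert ha]; ring
    rw [Finset.prod_insert ha, Derivation.leibniz, ih, h2]
    have h3 : derivative R (1 - C (c a) * X : R⟦X⟧) = - C (c a) := by simp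
    rw [h3, ← h1]
    simp only [smul_eq_mul]; ring
open PowerSeries in
/-- In a field containing `F⟦X⟧`, a positive power of `X` is not integral over `F[X⁻¹]`. -/
lemma PowerSeries.not_isIntegralElem_X_pow {F E : Type*} [Field F] [Field E] (i : F⟦X⟧ →+* E)
    (hi : Function.Injective i) {c : F} (hc : c ≠ 0) {D : ℕ} (hD : 0 < D) :
    ¬ (Polynomial.eval₂RingHom (i.comp C) (i X)⁻¹).IsIntegralElem (i (C c * X ^ D)) := by
  rintro ⟨g, hg, h0⟩
  set j : Polynomial F →+* E := Polynomial.eval₂RingHom (i.comp C) (i X)⁻¹ with hj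
  have hX : i X ≠ 0 := (map_ne_zero_iff i hi).2 X_ne_zero
  have hcc : i (C c) ≠ 0 := (map_ne_zero_iff i hi).2 (by simpa using hc)
  have hji : Function.Injective j := by
    rw [injective_iff_map_eq_zero]
    intro p hp
    rw [hj, Polynomial.coe_eval₂RingHom] at hp
    let _ : Invertible (i X) := invertibleOfNonzero hX
    rw [← invOf_eq_inv, ← Polynomial.eval₂_reverse_eq_zero_iff, invOf_invOf] at hp
    have h1 : i (p.reverse : F⟦X⟧) = 0 := by
      rw [← hp, ← Polynomial.eval₂_C_X_eq_coe, Polynomial.hom_eval₂]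
    rw [map_eq_zero_iff i hi, Polynomial.coe_eq_zero_iff] at h1
    simpa using h1
  have hy : i (C c * X ^ D) ≠ 0 := (map_ne_zero_iff i hi).2 (by simp [hc, X_ne_zero])
  let _ : Invertible (i (C c * X ^ D)) := invertibleOfNonzero hy
  have ha : (i (C c * X ^ D))⁻¹ = j (Polynomial.C c⁻¹ * Polynomial.X ^ D) := by
    have : i (C c) * i (C c⁻¹) = 1 := by rw [← map_mul, ← map_mul]; simp [hc]
    refine inv_eq_of_mul_eq_one_right ?_
    · simp only [hj, map_mul, map_pow, Polynomial.coe_eval₂RingHom, Polynomial.eval₂_C,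
        Polynomial.eval₂_X, RingHom.comp_apply]
      rw [mul_mul_mul_comm, this, ← mul_pow, mul_inv_cancel₀ hX]; simp
  rw [← Polynomial.eval₂_reverse_eq_zero_iff, invOf_eq_inv, ha, Polynomial.eval₂_hom,
    map_eq_zero_iff j hji] at h0
  have h1 := congrArg (Polynomial.eval 0) h0
  rw [← Polynomial.coe_evalRingHom, Polynomial.eval, Polynomial.hom_eval₂] at h1
  simp [hD.ne', Polynomial.eval₂_at_zero, Polynomial.coeff_zero_reverse, hg] at h1

namespace LaurentPolynomial
variable {F : Type*} [Field F]

/-- Laurent polynomials with exponents in `S`. -/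
def supportedIn [CharZero F] (S : Set ℤ) : Submodule ℚ F[T;T⁻¹] where
  carrier := {x | ∀ n, n ∉ S → x.coeff n = 0}
  add_mem' ha hb n hn := by simp [ha n hn, hb n hn]
  zero_mem' n hn := by simp
  smul_mem' c x hx n hn := by simp [hx n hn]

variable [CharZero F]

lemma supportedIn_mono {S S' : Set ℤ} (h : S ⊆ S') {x : F[T;T⁻¹]} (hx : x ∈ supportedIn S) :
    x ∈ supportedIn S' := fun n hn ↦ hx n fun h' ↦ hn (h h')

lemma mul_mem_supportedIn {S S' S'' : Set ℤ} (h : ∀ a ∈ S, ∀ b ∈ S', a + b ∈ S'')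
    {x y : F[T;T⁻¹]} (hx : x ∈ supportedIn S) (hy : y ∈ supportedIn S') :
    x * y ∈ supportedIn S'' := by
  intro n hn
  rw [AddMonoidAlgebra.coeff_mul]
  refine Finset.sum_eq_zero fun a _ ↦ Finset.sum_eq_zero fun b _ ↦ ?_
  dsimp only
  split_ifs with hab
  · by_cases ha : a ∈ S
    · by_cases hb : b ∈ S'
      · exact absurd (hab ▸ h a ha b hb) hn
      · simp [hy b hb]
    · simp [hx a ha]
  · rfl

lemma one_mem_supportedIn {S : Set ℤ} (h : 0 ∈ S) : (1 : F[T;T⁻¹]) ∈ supportedIn S := by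
  intro n hn
  have : n ≠ 0 := by rintro rfl; exact hn h
  rw [← T_zero, T, AddMonoidAlgebra.coeff_single]
  simp [this.symm]

/-- The part of a Laurent polynomial with exponents in `S`. -/
noncomputable def part (S : Set ℤ) [DecidablePred (· ∈ S)] (x : F[T;T⁻¹]) : F[T;T⁻¹] :=
  .ofCoeff (x.coeff.filter (· ∈ S))

lemma part_mem (S : Set ℤ) [DecidablePred (· ∈ S)] (x : F[T;T⁻¹]) : part S x ∈ supportedIn S := by
  intro n hn
  simp [part, hn]

omit [CharZero F] in
lemma part_add_part {x : F[T;T⁻¹]} (hx : x.coeff 0 = 0) :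
    part (Set.Iio 0) x + part (Set.Ioi 0) x = x := by
  ext n
  rcases lt_trichotomy n 0 with h | h | h
  · simp [part, h, h.not_gt]
  · simp [part, h, hx]
  · simp [part, h, h.not_gt]

omit [CharZero F] in
lemma coeff_T_mul (n m : ℤ) (x : F[T;T⁻¹]) : (T n * x).coeff m = x.coeff (m - n) := by
  rw [T, AddMonoidAlgebra.coeff_single_mul_apply, one_mul]
  congr 1; ring

/-- The constant term is multiplicative on Laurent polynomials supported on one side of `0`. -/
lemma coeff_zero_mul {S : Set ℤ} (hS : ∀ a ∈ S, ∀ b ∈ S, a + b = 0 → a = 0)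
    {x y : F[T;T⁻¹]} (hx : x ∈ supportedIn S) (hy : y ∈ supportedIn S) :
    (x * y).coeff 0 = x.coeff 0 * y.coeff 0 := by
  have h : UniqueAdd x.coeff.support y.coeff.support 0 0 := by
    intro a b ha hb hab
    have ha' : a ∈ S := by by_contra h; simp [hx a h] at ha
    have hb' : b ∈ S := by by_contra h; simp [hy b h] at hb
    have := hS a ha' b hb' (by simpa using hab)
    exact ⟨this, by simpa [this] using hab⟩
  simpa using AddMonoidAlgebra.coeff_mul_add_of_uniqueAdd h

end LaurentPolynomial

open PowerSeries in
/-- If all power sums of a nonempty family vanish, the family is not everywhere nonzero. -/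
lemma exists_eq_zero_of_sum_pow_eq_zero {F ι : Type*} [Field F] [CharZero F] [Fintype ι]
    [Nonempty ι] (c : ι → F) (hc : ∀ m : ℕ, 0 < m → ∑ r, c r ^ m = 0) : ∃ r, c r = 0 := by
  by_contra! h
  have h1 : ∏ r, (1 - C (c r) * X) = (1 : F⟦X⟧) := by
    refine eq_of_derivative_eq_mul (q := 0) (by simp [map_prod]) ?_ (by simp)
    rw [derivative_prod_one_sub]
    congr 1
    ext m
    simp [hc (m + 1) m.succ_pos]
  have h2 : ∏ r, (1 - Polynomial.C (c r) * Polynomial.X) = (1 : Polynomial F) := by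
    rw [← Polynomial.coe_inj, ← Polynomial.coeToPowerSeries.ringHom_apply]
    simpa [map_prod] using h1
  obtain ⟨r⟩ := ‹Nonempty ι›
  have h3 := congrArg (Polynomial.eval (c r)⁻¹) h2
  rw [Polynomial.eval_prod, Finset.prod_eq_zero (Finset.mem_univ r) (by simp [h r])] at h3
  simp at h3

namespace LaurentPolynomial
open PowerSeries (coeff)
open scoped PowerSeries
variable {F : Type*} [Field F]

/-- The embedding of polynomials over power series into power series over Laurent polynomials. -/
noncomputable def swapHom : Polynomial F⟦X⟧ →+* F[T;T⁻¹]⟦X⟧ :=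
  Polynomial.eval₂RingHom (PowerSeries.map C) (PowerSeries.C (T 1))

lemma coeff_swapHom (p : Polynomial F⟦X⟧) (m : ℕ) (n : ℤ) :
    (coeff m (swapHom p)).coeff n = if 0 ≤ n then coeff m (p.coeff n.toNat) else 0 := by
  induction p using Polynomial.induction_on' with
  | add p q hp hq =>
    rw [map_add, map_add, AddMonoidAlgebra.coeff_add, Finsupp.add_apply, hp, hq]
    split_ifs <;> simp
  | monomial j a =>
    have : coeff m (swapHom (Polynomial.monomial j a)) = .single (j : ℤ) (coeff m a) := by
      rw [swapHom, Polynomial.coe_eval₂RingHom, Polynomial.eval₂_monomial, ← map_pow,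
        PowerSeries.coeff_mul_C, PowerSeries.coeff_map, T_pow, mul_one, single_eq_C_mul_T]
    rw [this, AddMonoidAlgebra.coeff_single, Finsupp.single_apply, Polynomial.coeff_monomial]
    by_cases hn : 0 ≤ n
    · have : (j : ℤ) = n ↔ j = n.toNat := by omega
      simp only [hn, this, if_true]
      split_ifs <;> simp
    · have : (j : ℤ) ≠ n := by omega
      simp [hn, this]

lemma swapHom_injective : Function.Injective (swapHom (F := F)) := by
  intro p q h
  ext j m
  have := congrArg (fun y ↦ (coeff m y).coeff (j : ℤ)) h
  simpa [coeff_swapHom] using this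

lemma swapHom_map_C (p : Polynomial F) :
    swapHom (p.map PowerSeries.C) = PowerSeries.C (Polynomial.toLaurent p) := by
  induction p using Polynomial.induction_on' with
  | add p q hp hq => simp [hp, hq]
  | monomial n a =>
    simp [swapHom, ← Polynomial.C_mul_X_pow_eq_monomial, ← map_pow, T_pow]

variable [CharZero F]

lemma exists_swapHom_eq {N : ℕ} {Y : F[T;T⁻¹]⟦X⟧}
    (hY : ∀ m, coeff m Y ∈ supportedIn (Set.Icc 0 (N : ℤ))) :
    ∃ p : Polynomial F⟦X⟧, p.natDegree ≤ N ∧ swapHom p = Y := by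
  let p : Polynomial F⟦X⟧ := ∑ j ∈ Finset.range (N + 1),
    Polynomial.monomial j (PowerSeries.mk fun m ↦ (coeff m Y).coeff j)
  have hp (j : ℕ) : p.coeff j =
      if j < N + 1 then PowerSeries.mk fun m ↦ (coeff m Y).coeff j else 0 := by
    simp [p, Polynomial.coeff_monomial]
  refine ⟨p, Polynomial.natDegree_le_iff_coeff_eq_zero.2 fun j hj ↦ ?_, ?_⟩
  · rw [hp, if_neg (by omega)]
  · ext m n
    rw [coeff_swapHom]
    split_ifs with hn
    · rw [hp]
      split_ifs with h
      · simp [Int.toNat_of_nonneg hn]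
      · rw [hY m n (by simp; omega)]; simp
    · rw [hY m n (by simp [hn])]

lemma coeff_prod_one_sub_mem {ι : Type*} (s : Finset ι) (G : ι → F[T;T⁻¹]) {k l : ℕ}
    (hG : ∀ r ∈ s, G r ∈ supportedIn (Set.Icc (-k : ℤ) l)) (m : ℕ) :
    coeff m (∏ r ∈ s, (1 - PowerSeries.C (G r) * PowerSeries.X)) ∈
      supportedIn (Set.Icc (-(s.card * k : ℕ) : ℤ) (s.card * l : ℕ)) := by
  classical
  induction s using Finset.induction generalizing m with
  | empty =>
    rw [Finset.prod_empty, PowerSeries.coeff_one]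
    split_ifs
    · exact one_mem_supportedIn (by simp)
    · exact zero_mem _
  | insert a s ha ih =>
    have ih' := ih fun r hr ↦ hG r (Finset.mem_insert_of_mem hr)
    rw [Finset.prod_insert ha, sub_mul, one_mul, map_sub, mul_assoc, PowerSeries.coeff_C_mul,
      Finset.card_insert_of_notMem ha]
    refine sub_mem (supportedIn_mono (Set.Icc_subset_Icc ?_ ?_) (ih' m)) ?_
    · push_cast; nlinarith
    · push_cast; nlinarith
    · cases m with
      | zero => simp
      | succ m =>
        rw [PowerSeries.coeff_succ_X_mul]
        refine mul_mem_supportedIn ?_ (hG a (Finset.mem_insert_self a s)) (ih' m)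
        rintro x ⟨hx, hx'⟩ y ⟨hy, hy'⟩
        push_cast at *
        constructor <;> linarith

lemma coeff_mul_mem_supportedIn {S S' S'' : Set ℤ} (h : ∀ a ∈ S, ∀ b ∈ S', a + b ∈ S'')
    {Y Z : F[T;T⁻¹]⟦X⟧} (hY : ∀ m, coeff m Y ∈ supportedIn S)
    (hZ : ∀ m, coeff m Z ∈ supportedIn S') (m : ℕ) : coeff m (Y * Z) ∈ supportedIn S'' := by
  rw [PowerSeries.coeff_mul]
  exact sum_mem fun x _ ↦ mul_mem_supportedIn h (hY _) (hZ _)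

lemma coeff_mem_of_succ {S : Set ℤ} {Y : F[T;T⁻¹]⟦X⟧} (h0 : PowerSeries.constantCoeff Y = 1)
    (hS : 0 ∈ S) (h : ∀ m, coeff (m + 1) Y ∈ supportedIn S) (m : ℕ) :
    coeff m Y ∈ supportedIn S := by
  cases m with
  | zero => simpa [h0] using one_mem_supportedIn hS
  | succ m => exact h m

/-- If the constant terms of the power sums of the `G r` vanish, then `∏ (1 - G r X)` factors
into a part with nonpositive and a part with nonnegative exponents, both having
constant term `1`. -/
lemma exists_factorization {ι : Type*} [Fintype ι] (G : ι → F[T;T⁻¹]) {k l : ℕ}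
    (hG : ∀ r, G r ∈ supportedIn (Set.Icc (-k : ℤ) l))
    (h0 : ∀ m : ℕ, 0 < m → ∑ r, (G r ^ m).coeff 0 = 0) :
    ∃ A B : F[T;T⁻¹]⟦X⟧, A * B = ∏ r, (1 - PowerSeries.C (G r) * PowerSeries.X) ∧
      (∀ m, coeff m A ∈ supportedIn (Set.Icc (-(Fintype.card ι * k : ℕ) : ℤ) 0)) ∧
      (∀ m, coeff m B ∈ supportedIn (Set.Icc 0 (Fintype.card ι * l : ℕ))) ∧
      (∀ m, (coeff m A).coeff 0 = if m = 0 then 1 else 0) ∧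
      (∀ m, (coeff m B).coeff 0 = if m = 0 then 1 else 0) := by
  set H : F[T;T⁻¹]⟦X⟧ := ∏ r, (1 - PowerSeries.C (G r) * PowerSeries.X) with hH
  let q : F[T;T⁻¹]⟦X⟧ := PowerSeries.mk fun m ↦ -∑ r, G r ^ (m + 1)
  obtain ⟨A, B, A', B', hAB, hA, hB, A0, B0, A0', B0', mA, mB, mA', mB'⟩ :=
    PowerSeries.exists_wienerHopf (supportedIn (F := F) (Set.Iio 0)) (supportedIn (Set.Ioi 0))
      (fun a ha b hb ↦ mul_mem_supportedIn
        (fun x hx y hy ↦ by simp only [Set.mem_Iio] at *; omega) ha hb)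
      (fun a ha b hb ↦ mul_mem_supportedIn
        (fun x hx y hy ↦ by simp only [Set.mem_Ioi] at *; omega) ha hb)
      H (PowerSeries.mk fun m ↦ part (Set.Iio 0) (coeff m q))
      (PowerSeries.mk fun m ↦ part (Set.Ioi 0) (coeff m q))
      (fun m ↦ by rw [PowerSeries.coeff_mk]; exact part_mem _ _)
      (fun m ↦ by rw [PowerSeries.coeff_mk]; exact part_mem _ _)
      (by simp [hH, map_prod])
      (by
        rw [hH, PowerSeries.derivative_prod_one_sub]
        congr 1
        ext1 m
        simp only [map_add, PowerSeries.coeff_mk, q]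
        rw [part_add_part (by simp [h0 (m + 1) m.succ_pos])])
  have mH := coeff_prod_one_sub_mem Finset.univ G (fun r _ ↦ hG r)
  rw [← hH, Finset.card_univ] at mH
  have const_term {S : Set ℤ} (hS : 0 ∉ S) {Y : F[T;T⁻¹]⟦X⟧}
      (hY : PowerSeries.constantCoeff Y = 1) (mY : ∀ m, coeff (m + 1) Y ∈ supportedIn S) (m : ℕ) :
      (coeff m Y).coeff 0 = if m = 0 then 1 else 0 := by
    cases m with
    | zero => rw [PowerSeries.coeff_zero_eq_constantCoeff_apply, hY]; simp
    | succ m => simpa using mY m 0 hS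
  have le {Y : F[T;T⁻¹]⟦X⟧} (hY : PowerSeries.constantCoeff Y = 1)
      (mY : ∀ m, coeff (m + 1) Y ∈ supportedIn (Set.Iio 0)) :=
    coeff_mem_of_succ hY (Set.mem_Iic.2 le_rfl)
      fun m ↦ supportedIn_mono Set.Iio_subset_Iic_self (mY m)
  have ge {Y : F[T;T⁻¹]⟦X⟧} (hY : PowerSeries.constantCoeff Y = 1)
      (mY : ∀ m, coeff (m + 1) Y ∈ supportedIn (Set.Ioi 0)) :=
    coeff_mem_of_succ hY (Set.mem_Ici.2 le_rfl)
      fun m ↦ supportedIn_mono Set.Ioi_subset_Ici_self (mY m)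
  refine ⟨A, B, hAB, fun m n hn ↦ ?_, fun m n hn ↦ ?_, const_term (by simp) A0 mA,
    const_term (by simp) B0 mB⟩
  · by_cases h : n ≤ 0
    · rw [hA]
      refine coeff_mul_mem_supportedIn (S'' := Set.Ici (-(Fintype.card ι * k : ℕ) : ℤ)) ?_ mH
        (ge B0' mB') m n (fun h' ↦ hn ⟨h', h⟩)
      rintro a ⟨ha, -⟩ b hb
      simp only [Set.mem_Ici] at *
      omega
    · exact le A0 mA m n h
  · by_cases h : 0 ≤ n
    · rw [hB]
      refine coeff_mul_mem_supportedIn (S'' := Set.Iic ((Fintype.card ι * l : ℕ) : ℤ)) ?_ mH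
        (le A0' mA') m n (fun h' ↦ hn ⟨h, h'⟩)
      rintro a ⟨-, ha⟩ b hb
      simp only [Set.mem_Iic] at *
      omega
    · exact ge B0 mB m n h

/-- A family of Laurent polynomials with a common pair of extreme exponents of opposite signs has
a power sum with nonzero constant term. -/
theorem exists_sum_coeff_zero_pow_ne_zero {ι : Type*} [Fintype ι] [Nonempty ι]
    (G : ι → F[T;T⁻¹]) {k l : ℕ} (hk : 0 < k) (hl : 0 < l)
    (hG : ∀ r, G r ∈ supportedIn (Set.Icc (-k : ℤ) l))
    (hGk : ∀ r, (G r).coeff (-k) ≠ 0) (hGl : ∀ r, (G r).coeff l ≠ 0) :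
    ∃ m : ℕ, 0 < m ∧ ∑ r, (G r ^ m).coeff 0 ≠ 0 := by
  by_contra! h0
  obtain ⟨A, B, hAB, mA, mB, cA, cB⟩ := exists_factorization G hG h0
  set K := Fintype.card ι * k with hK
  -- the nonpositive factor, as a monic polynomial over power series
  obtain ⟨W, hWdeg, hW⟩ := exists_swapHom_eq (N := K) (Y := PowerSeries.C (T K) * A) (by
    intro m n hn
    rw [PowerSeries.coeff_C_mul, coeff_T_mul]
    refine mA m _ fun h ↦ hn ?_
    simp only [Set.mem_Icc] at *
    omega)
  obtain ⟨V, -, hV⟩ := exists_swapHom_eq mB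
  have coeffW (j : ℕ) : W.coeff j = PowerSeries.mk fun m ↦ (coeff m A).coeff (j - K) := by
    ext m
    have := coeff_swapHom W m j
    rw [hW, PowerSeries.coeff_C_mul, coeff_T_mul] at this
    simpa using this.symm
  have coeffV : V.coeff 0 = 1 := by
    ext m
    have := coeff_swapHom V m 0
    rw [hV, cB] at this
    simpa [PowerSeries.coeff_one] using this.symm
  have monicW : W.Monic := by
    refine Polynomial.monic_of_natDegree_le_of_coeff_eq_one K hWdeg ?_
    rw [coeffW]
    ext m
    simp [cA, PowerSeries.coeff_one]
  -- the polynomials `T ^ k * G r`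
  let g (r : ι) : Polynomial F := ∑ j ∈ Finset.range (k + l + 1),
    Polynomial.monomial j ((G r).coeff (j - k))
  have coeffg (r : ι) (j : ℕ) : (g r).coeff j = if j < k + l + 1 then (G r).coeff (j - k) else 0 := by
    simp [g, Polynomial.coeff_monomial]
  have degg (r : ι) : (g r).natDegree ≤ k + l :=
    Polynomial.natDegree_le_iff_coeff_eq_zero.2 fun j hj ↦ by rw [coeffg, if_neg (by omega)]
  have hg (r : ι) : Polynomial.toLaurent (g r) = T k * G r := by
    ext n
    rw [coeff_T_mul]
    simp only [g, map_sum, ← Polynomial.C_mul_X_pow_eq_monomial, Polynomial.toLaurent_C_mul_X_pow,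
      ← single_eq_C_mul_T, AddMonoidAlgebra.coeff_sum, AddMonoidAlgebra.coeff_single,
      Finsupp.finsetSum_apply, Finsupp.single_apply]
    by_cases hn : n ∈ Set.Icc (0 : ℤ) (k + l)
    · obtain ⟨h1, h2⟩ := hn
      lift n to ℕ using h1
      have : n < k + l + 1 := by omega
      simp [this]
    · rw [Finset.sum_eq_zero, hG r (n - k)]
      · simp only [Set.mem_Icc] at *; omega
      · intro j hj
        rw [if_neg]
        rintro rfl
        simp at hj hn
        omega
  let P (r : ι) : Polynomial F⟦X⟧ :=
    Polynomial.X ^ k - Polynomial.C PowerSeries.X * (g r).map PowerSeries.C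
  have hP : W * V = ∏ r, P r := by
    apply swapHom_injective
    have h1 (r : ι) : swapHom (P r) =
        PowerSeries.C (T k) * (1 - PowerSeries.C (G r) * PowerSeries.X) := by
      have h2 : swapHom (Polynomial.X : Polynomial F⟦X⟧) = PowerSeries.C (T 1) := by simp [swapHom]
      have h3 : swapHom (Polynomial.C (PowerSeries.X : F⟦X⟧)) = PowerSeries.X := by simp [swapHom]
      simp only [P, map_sub, map_mul, map_pow, h2, h3, swapHom_map_C, hg]
      rw [← map_pow, T_pow, mul_one]
      ring
    rw [map_mul, hW, hV, mul_assoc, hAB, map_prod, Finset.prod_congr rfl fun r _ ↦ h1 r,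
      Finset.prod_mul_distrib, Finset.prod_const, ← map_pow, T_pow, Finset.card_univ, hK]
    push_cast
    rfl
  have hW0 : W.coeff 0 = PowerSeries.C (∏ r, -(G r).coeff (-k)) *
      PowerSeries.X ^ Fintype.card ι := by
    have := congrArg (fun p ↦ Polynomial.coeff p 0) hP
    simp only [Polynomial.mul_coeff_zero, coeffV, mul_one] at this
    rw [this, Polynomial.coeff_zero_prod, map_prod]
    have h1 (r : ι) : (P r).coeff 0 = PowerSeries.C (-(G r).coeff (-k)) * PowerSeries.X := by
      simp [P, hk.ne, coeffg]
      ring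
    rw [Finset.prod_congr rfl fun r _ ↦ h1 r, Finset.prod_mul_distrib, Finset.prod_const,
      Finset.card_univ]
  -- integrality of `W.coeff 0` over `F[X⁻¹]`
  let i : F⟦X⟧ →+* FractionRing F⟦X⟧ := algebraMap _ _
  have hi : Function.Injective i := IsFractionRing.injective _ _
  have hX : i PowerSeries.X ≠ 0 := (map_ne_zero_iff i hi).2 PowerSeries.X_ne_zero
  let j := Polynomial.eval₂RingHom (i.comp PowerSeries.C) (i PowerSeries.X)⁻¹
  let M (r : ι) : Polynomial (Polynomial F) := Polynomial.C (Polynomial.C ((G r).coeff l)⁻¹) *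
    ((g r).map Polynomial.C - Polynomial.C Polynomial.X * Polynomial.X ^ k)
  have monicM (r : ι) : (M r).Monic := by
    refine Polynomial.monic_of_natDegree_le_of_coeff_eq_one (k + l) ?_ ?_
    · refine (Polynomial.natDegree_C_mul_le _ _).trans ((Polynomial.natDegree_sub_le _ _).trans ?_)
      refine max_le (Polynomial.natDegree_map_le.trans (degg r)) ?_
      exact (Polynomial.natDegree_C_mul_X_pow_le _ _).trans (by omega)
    · simp [M, coeffg, Polynomial.coeff_X_pow, hl.ne', ← map_mul, hGl r]
  have hPM (r : ι) : (P r).map i ∣ (M r).map j := by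
    refine ⟨Polynomial.C (-(i (PowerSeries.C ((G r).coeff l)⁻¹) * (i PowerSeries.X)⁻¹)), ?_⟩
    have h1 : (g r).map (j.comp Polynomial.C) = (g r).map (i.comp PowerSeries.C) := by
      congr 1; ext; simp [j]
    have h2 : Polynomial.C (i PowerSeries.X) * Polynomial.C (i PowerSeries.X)⁻¹ = 1 := by
      rw [← map_mul, mul_inv_cancel₀ hX, map_one]
    have h3 : j Polynomial.X = (i PowerSeries.X)⁻¹ := by simp [j]
    have h4 (a : F) : j (Polynomial.C a) = i (PowerSeries.C a) := by simp [j]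
    simp only [M, P, Polynomial.map_mul, Polynomial.map_sub, Polynomial.map_pow, Polynomial.map_C,
      Polynomial.map_X, Polynomial.map_map, h1, h3, h4, map_neg, map_mul]
    linear_combination (-(Polynomial.C (i (PowerSeries.C ((G r).coeff l)⁻¹)) *
      (g r).map (i.comp PowerSeries.C))) * h2
  let _ := j.toAlgebra
  have := Polynomial.isIntegral_coeff_of_dvd (∏ r, M r) (W.map i)
    (Polynomial.monic_prod_of_monic _ _ fun r _ ↦ monicM r) (monicW.map i) (by
      refine (Dvd.intro (V.map i) (by rw [← Polynomial.map_mul, hP])).trans ?_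
      rw [Polynomial.map_prod, Polynomial.map_prod]
      exact Finset.prod_dvd_prod_of_dvd _ _ fun r _ ↦ hPM r) 0
  rw [Polynomial.coeff_map, hW0] at this
  exact PowerSeries.not_isIntegralElem_X_pow i hi
    (Finset.prod_ne_zero_iff.2 fun r _ ↦ neg_ne_zero.2 (hGk r)) Fintype.card_pos this

end LaurentPolynomial

namespace MvPolynomial
open LaurentPolynomial (supportedIn exists_sum_coeff_zero_pow_ne_zero coeff_zero_mul)
variable {K : Type*} [Field K]

/-- The value at the point `c` of the monomial with exponents `d`. -/
def monomialEval (c : Fin 2 → K) (d : Fin 2 →₀ ℕ) : K := c 0 ^ d 0 * c 1 ^ d 1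

/-- Polynomials without monomials whose value at the point `c` is `1`. -/
def avoiding (c : Fin 2 → K) : Submodule K (MvPolynomial (Fin 2) K) where
  carrier := {g | ∀ d, monomialEval c d = 1 → coeff d g = 0}
  add_mem' ha hb d hd := by simp [ha d hd, hb d hd]
  zero_mem' d _ := by simp
  smul_mem' a x hx d hd := by simp [hx d hd]

/-- The substitution multiplying the variables by the entries of `c`. -/
noncomputable def rescale (c : Fin 2 → K) :
    MvPolynomial (Fin 2) K →ₐ[K] MvPolynomial (Fin 2) K :=
  aeval fun i ↦ c i • X i

lemma coeff_rescale (c : Fin 2 → K) (f : MvPolynomial (Fin 2) K) (d : Fin 2 →₀ ℕ) :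
    coeff d (rescale c f) = monomialEval c d * coeff d f := by
  induction f using MvPolynomial.induction_on' with
  | add p q hp hq => simp [hp, hq, mul_add]
  | monomial e a =>
    have : rescale c (monomial e a) = monomial e (monomialEval c e * a) := by
      rw [rescale, aeval_monomial, monomial_eq, Finsupp.prod_fintype _ _ (by simp),
        Finsupp.prod_fintype _ _ (by simp)]
      simp only [Fin.prod_univ_two, algebraMap_eq, smul_eq_C_mul, monomialEval, map_mul,
        map_pow]
      ring
    rw [this, coeff_monomial, coeff_monomial]
    split_ifs with h
    · rw [h]
    · simp

/-- The grading of monomials given by the linear form `(i, j) ↦ q * i - p * j`. -/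
def slope (p q : ℕ) : (Fin 2 →₀ ℕ) →+ ℤ where
  toFun d := q * d 0 - p * d 1
  map_zero' := by simp
  map_add' d e := by simp; ring

lemma slope_apply (p q : ℕ) (d : Fin 2 →₀ ℕ) : slope p q d = q * d 0 - p * d 1 := rfl

/-- The homomorphism which records `slope p q` as the exponent of `T` and the total degree as an
exponent of the variable of the coefficient field. -/
noncomputable def toLaurent (p q : ℕ) :
    MvPolynomial (Fin 2) K →+* LaurentPolynomial (FractionRing (Polynomial K)) :=
  eval₂Hom (LaurentPolynomial.C.comp (algebraMap K _))
    fun i ↦ LaurentPolynomial.C (algebraMap (Polynomial K) _ Polynomial.X) *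
      LaurentPolynomial.T (if i = 0 then (q : ℤ) else -p)

lemma toLaurent_monomial (p q : ℕ) (d : Fin 2 →₀ ℕ) (a : K) :
    toLaurent p q (monomial d a) = AddMonoidAlgebra.single (slope p q d)
      (algebraMap (Polynomial K) _ (Polynomial.monomial (d 0 + d 1) a)) := by
  rw [toLaurent, coe_eval₂Hom, eval₂_monomial, Finsupp.prod_fintype _ _ (by simp),
    LaurentPolynomial.single_eq_C_mul_T, slope_apply, sub_eq_add_neg, LaurentPolynomial.T_add,
    ← Polynomial.C_mul_X_pow_eq_monomial, IsScalarTower.algebraMap_eq K (Polynomial K)]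
  simp only [Fin.prod_univ_two, mul_pow, LaurentPolynomial.T_pow, map_mul, map_pow, pow_add,
    RingHom.comp_apply, Polynomial.algebraMap_eq, if_true, one_ne_zero, if_false]
  rw [mul_comm (d 0 : ℤ), mul_comm (p : ℤ), mul_neg]
  ring

lemma coeff_toLaurent (p q : ℕ) (f : MvPolynomial (Fin 2) K) (n : ℤ) :
    (toLaurent p q f).coeff n = algebraMap (Polynomial K) _
      (∑ d ∈ f.support with slope p q d = n, Polynomial.monomial (d 0 + d 1) (coeff d f)) := by
  conv_lhs => rw [f.as_sum]
  simp only [map_sum, toLaurent_monomial, AddMonoidAlgebra.coeff_sum,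
    AddMonoidAlgebra.coeff_single, Finsupp.finsetSum_apply, Finsupp.single_apply,
    Finset.sum_filter, apply_ite (algebraMap (Polynomial K) (FractionRing (Polynomial K))),
    map_zero]

lemma coeff_toLaurent_eq_zero_iff {p q : ℕ} (hpq : 0 < p + q) (f : MvPolynomial (Fin 2) K)
    (n : ℤ) : (toLaurent p q f).coeff n = 0 ↔ ∀ d, slope p q d = n → coeff d f = 0 := by
  rw [coeff_toLaurent, map_eq_zero_iff _ (IsFractionRing.injective _ _)]
  refine ⟨fun h d hd ↦ ?_, fun h ↦ Finset.sum_eq_zero fun d hd ↦ ?_⟩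
  · have h1 := congrArg (fun g ↦ Polynomial.coeff g (d 0 + d 1)) h
    simp only [Polynomial.finsetSum_coeff, Polynomial.coeff_monomial, Polynomial.coeff_zero] at h1
    rw [Finset.sum_eq_single d] at h1
    · simpa using h1
    · intro e he hed
      rw [if_neg]
      intro hs
      apply hed
      have h2 := (Finset.mem_filter.1 he).2
      rw [← hd, slope_apply, slope_apply] at h2
      have hs' : (e 0 : ℤ) + e 1 = d 0 + d 1 := by exact_mod_cast hs
      have hpq' : (p + q : ℤ) ≠ 0 := by exact_mod_cast hpq.ne'
      have h3 : (e 0 : ℤ) = d 0 := mul_left_cancel₀ hpq' (by linear_combination h2 + p * hs')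
      have h4 : (e 1 : ℤ) = d 1 := by linarith
      ext i
      fin_cases i
      · exact_mod_cast h3
      · exact_mod_cast h4
    · intro hd'
      by_cases h2 : coeff d f = 0
      · simp [h2]
      · exact absurd (Finset.mem_filter.2 ⟨mem_support_iff.2 h2, hd⟩) hd'
  · rw [h d (Finset.mem_filter.1 hd).2, map_zero]

/-- If all monomials of `f` have positive weight, so have those of `b * f ^ m` for large `m`. -/
lemma exists_forall_pos_of_mem_support_mul_pow (w : (Fin 2 →₀ ℕ) →+ ℤ)
    (f b : MvPolynomial (Fin 2) K) (hf : ∀ d ∈ f.support, 0 < w d) :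
    ∃ N : ℕ, ∀ m, N ≤ m → ∀ d ∈ (b * f ^ m).support, 0 < w d := by
  have hpow (m : ℕ) : ∀ d ∈ (f ^ m).support, m ≤ w d := by
    induction m with
    | zero =>
      intro d hd
      have : d = 0 := by
        simpa using hd
      simp [this]
    | succ m ih =>
      intro d hd
      rw [pow_succ] at hd
      obtain ⟨x, hx, y, hy, rfl⟩ := Finset.mem_add.1 (support_mul _ _ hd)
      have := ih x hx
      have := hf y hy
      rw [map_add]
      push_cast
      omega
  obtain ⟨N, hN⟩ : ∃ N : ℕ, ∀ d ∈ b.support, -(N : ℤ) < w d := by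
    refine ⟨∑ d ∈ b.support, ((w d).natAbs + 1), fun d hd ↦ ?_⟩
    have := Finset.single_le_sum (f := fun d ↦ (w d).natAbs + 1) (fun _ _ ↦ Nat.zero_le _) hd
    omega
  refine ⟨N, fun m hm d hd ↦ ?_⟩
  obtain ⟨x, hx, y, hy, rfl⟩ := Finset.mem_add.1 (support_mul _ _ hd)
  have := hN x hx
  have := hpow m y hy
  rw [map_add]
  omega

lemma monomialEval_pow (c : Fin 2 → K) (r : ℕ) (d : Fin 2 →₀ ℕ) :
    monomialEval (fun i ↦ c i ^ r) d = monomialEval c d ^ r := by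
  simp only [monomialEval, mul_pow, ← pow_mul, mul_comm]

lemma monomialEval_pow_eq_one {c : Fin 2 → K} {p q : ℕ} (hc : c 0 ^ p * c 1 ^ q = 1)
    {d : Fin 2 →₀ ℕ} (hd : slope p q d = 0) : monomialEval c d ^ (p + q) = 1 := by
  rw [slope_apply, sub_eq_zero] at hd
  have h : q * d 0 = p * d 1 := by exact_mod_cast hd
  have h0 : d 0 * (p + q) = p * (d 0 + d 1) := by linear_combination h
  have h1 : d 1 * (p + q) = q * (d 0 + d 1) := by linear_combination -h
  rw [monomialEval, mul_pow, ← pow_mul, ← pow_mul, h0, h1, pow_mul, pow_mul, ← mul_pow, hc,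
    one_pow]

lemma sum_coeff_toLaurent_rescale_pow {c : Fin 2 → K} {p q : ℕ} (hpq : 0 < p + q)
    (hc : c 0 ^ p * c 1 ^ q = 1) {f : MvPolynomial (Fin 2) K} {m : ℕ} (hf : f ^ m ∈ avoiding c) :
    ∑ r : Fin (p + q), (toLaurent p q (rescale (fun i ↦ c i ^ (r : ℕ)) f) ^ m).coeff 0 = 0 := by
  rw [← Finsupp.finsetSum_apply, ← AddMonoidAlgebra.coeff_sum]
  simp only [← map_pow, ← map_sum]
  rw [coeff_toLaurent_eq_zero_iff hpq]
  intro d hd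
  simp only [coeff_sum, coeff_rescale, monomialEval_pow, ← Finset.sum_mul]
  by_cases h1 : monomialEval c d = 1
  · rw [hf d h1, mul_zero]
  · rw [Fin.sum_univ_eq_sum_range (fun r ↦ monomialEval c d ^ r)]
    have := geom_sum_mul (monomialEval c d) (p + q)
    rw [monomialEval_pow_eq_one hc hd, sub_self, mul_eq_zero, sub_eq_zero] at this
    rw [this.resolve_right h1, zero_mul]

variable [CharZero K]

instance : CharZero (FractionRing (Polynomial K)) :=
  charZero_of_injective_algebraMap (IsFractionRing.injective (Polynomial K) _)

lemma forall_slope_pos_or_forall_slope_neg {c : Fin 2 → K} {p q : ℕ} (hpq : 0 < p + q)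
    (hc : c 0 ^ p * c 1 ^ q = 1) {f : MvPolynomial (Fin 2) K}
    (hf : ∀ m : ℕ, 0 < m → f ^ m ∈ avoiding c) :
    (∀ d ∈ f.support, 0 < slope p q d) ∨ (∀ d ∈ f.support, slope p q d < 0) := by
  have : Nonempty (Fin (p + q)) := ⟨⟨0, hpq⟩⟩
  set G : Fin (p + q) → LaurentPolynomial (FractionRing (Polynomial K)) :=
    fun r ↦ toLaurent p q (rescale (fun i ↦ c i ^ (r : ℕ)) f) with hG
  have hsum (m : ℕ) (hm : 0 < m) : ∑ r, (G r ^ m).coeff 0 = 0 :=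
    sum_coeff_toLaurent_rescale_pow hpq hc (hf m hm)
  have mem {S : Set ℤ} (hS : ∀ d ∈ f.support, slope p q d ∈ S) (r : Fin (p + q)) :
      G r ∈ supportedIn S := by
    intro n hn
    rw [hG, coeff_toLaurent_eq_zero_iff hpq]
    rintro d rfl
    rw [coeff_rescale, notMem_support_iff.1 fun h ↦ hn (hS d h), mul_zero]
  have coeff_ne {d : Fin 2 →₀ ℕ} (hd : d ∈ f.support) (hcd : monomialEval c d ≠ 0)
      (r : Fin (p + q)) : (G r).coeff (slope p q d) ≠ 0 := by
    rw [hG, Ne, coeff_toLaurent_eq_zero_iff hpq]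
    intro h
    have := h d rfl
    rw [coeff_rescale, monomialEval_pow] at this
    exact mul_ne_zero (pow_ne_zero _ hcd) (mem_support_iff.1 hd) this
  -- a support touching the ray `slope p q d = 0` from one side
  have one_sided {S : Set ℤ} (hS : ∀ d ∈ f.support, slope p q d ∈ S) (h0 : (0 : ℤ) ∈ S)
      (hadd : ∀ a ∈ S, ∀ b ∈ S, a + b ∈ S) (hzero : ∀ a ∈ S, ∀ b ∈ S, a + b = 0 → a = 0) :
      ∀ d ∈ f.support, slope p q d ≠ 0 := by
    intro d hd hd0
    have hpow (r : Fin (p + q)) (m : ℕ) :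
        G r ^ m ∈ supportedIn S ∧ (G r ^ m).coeff 0 = (G r).coeff 0 ^ m := by
      induction m with
      | zero => exact ⟨by simpa using LaurentPolynomial.one_mem_supportedIn h0, by simp⟩
      | succ m ih =>
        rw [pow_succ, pow_succ]
        exact ⟨LaurentPolynomial.mul_mem_supportedIn hadd ih.1 (mem hS r),
          by rw [coeff_zero_mul hzero ih.1 (mem hS r), ih.2]⟩
    obtain ⟨r, hr⟩ := exists_eq_zero_of_sum_pow_eq_zero (fun r ↦ (G r).coeff 0) fun m hm ↦ by
      simpa only [(hpow _ m).2] using hsum m hm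
    refine coeff_ne hd (fun h ↦ ?_) r (by rw [hd0, hr])
    have := monomialEval_pow_eq_one hc hd0
    rw [h, zero_pow hpq.ne'] at this
    exact zero_ne_one this
  by_cases hneg : ∃ d ∈ f.support, slope p q d < 0
  swap
  · push Not at hneg
    left
    intro d hd
    refine lt_of_le_of_ne (hneg d hd) (Ne.symm (one_sided (S := Set.Ici 0) hneg (by simp)
      (fun a ha b hb ↦ Set.mem_Ici.2 (add_nonneg ha hb)) (fun a ha b hb h ↦ ?_) d hd))
    simp only [Set.mem_Ici] at ha hb
    omega
  by_cases hpos : ∃ d ∈ f.support, 0 < slope p q d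
  swap
  · push Not at hpos
    right
    intro d hd
    refine lt_of_le_of_ne (hpos d hd) (one_sided (S := Set.Iic 0) hpos (by simp)
      (fun a ha b hb ↦ Set.mem_Iic.2 (add_nonpos ha hb)) (fun a ha b hb h ↦ ?_) d hd)
    simp only [Set.mem_Iic] at ha hb
    omega
  exfalso
  obtain ⟨d₁, hd₁, hd₁'⟩ := hneg
  obtain ⟨d₂, hd₂, hd₂'⟩ := hpos
  have hp : p ≠ 0 := by
    rintro rfl
    rw [slope_apply] at hd₁'
    have : (0 : ℤ) ≤ q * d₁ 0 := by positivity
    simp at hd₁'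
    omega
  have hq : q ≠ 0 := by
    rintro rfl
    rw [slope_apply] at hd₂'
    have : (0 : ℤ) ≤ p * d₂ 1 := by positivity
    simp at hd₂'
    omega
  have hc0 : c 0 ≠ 0 := by
    intro h
    simp [h, hp] at hc
  have hc1 : c 1 ≠ 0 := by
    intro h
    simp [h, hq] at hc
  have hcd (d : Fin 2 →₀ ℕ) : monomialEval c d ≠ 0 :=
    mul_ne_zero (pow_ne_zero _ hc0) (pow_ne_zero _ hc1)
  obtain ⟨a, ha, hamin⟩ := f.support.exists_min_image (slope p q) ⟨d₁, hd₁⟩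
  obtain ⟨b, hb, hbmax⟩ := f.support.exists_max_image (slope p q) ⟨d₂, hd₂⟩
  obtain ⟨k, hk⟩ : ∃ k : ℕ, slope p q a = -k :=
    ⟨(-slope p q a).toNat, by have := hamin d₁ hd₁; omega⟩
  obtain ⟨l, hl⟩ : ∃ l : ℕ, slope p q b = l :=
    ⟨(slope p q b).toNat, by have := hbmax d₂ hd₂; omega⟩
  obtain ⟨m, hm, hne⟩ := exists_sum_coeff_zero_pow_ne_zero G (k := k) (l := l)
    (by have := hamin d₁ hd₁; omega) (by have := hbmax d₂ hd₂; omega)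
    (mem fun d hd ↦ ⟨hk ▸ hamin d hd, hl ▸ hbmax d hd⟩)
    (hk ▸ coeff_ne ha (hcd a)) (hl ▸ coeff_ne hb (hcd b))
  exact hne (hsum m hm)

omit [CharZero K] in
lemma exists_pow_eq_one_of_pow_eq_pow {a : K} (ha : a ≠ 0) {m n : ℕ} (hmn : m ≠ n)
    (h : a ^ m = a ^ n) : ∃ D : ℕ, 0 < D ∧ a ^ D = 1 := by
  wlog hlt : m < n generalizing m n
  · exact this hmn.symm h.symm (by omega)
  exact ⟨n - m, by omega, by rw [pow_sub₀ a ha hlt.le, ← h, mul_inv_cancel₀ (pow_ne_zero m ha)]⟩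

omit [CharZero K] in
lemma eq_zero_of_pow_mem_avoiding {c : Fin 2 → K} {d e : Fin 2 →₀ ℕ} (hd : monomialEval c d = 1)
    (he : monomialEval c e = 1) (hde : d 1 * e 0 ≠ d 0 * e 1) {f : MvPolynomial (Fin 2) K}
    (hf : ∀ m : ℕ, 0 < m → f ^ m ∈ avoiding c) : f = 0 := by
  simp only [monomialEval] at hd he
  have hne (i : Fin 2) (h : d i ≠ 0 ∨ e i ≠ 0) : c i ≠ 0 := by
    intro h0
    fin_cases i <;> rcases h with h | h <;> simp_all
  have h0 : c 0 ≠ 0 := hne 0 (by by_contra! h; simp [h] at hde)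
  have h1 : c 1 ≠ 0 := hne 1 (by by_contra! h; simp [h] at hde)
  obtain ⟨D₀, hD₀, hD₀'⟩ : ∃ D : ℕ, 0 < D ∧ c 0 ^ D = 1 := by
    refine exists_pow_eq_one_of_pow_eq_pow h0 hde ?_
    refine mul_right_cancel₀ (pow_ne_zero (d 1 * e 1) h1) ?_
    calc _ = (c 0 ^ e 0 * c 1 ^ e 1) ^ d 1 := by ring
      _ = (c 0 ^ d 0 * c 1 ^ d 1) ^ e 1 := by rw [hd, he, one_pow, one_pow]
      _ = _ := by ring
  obtain ⟨D₁, hD₁, hD₁'⟩ : ∃ D : ℕ, 0 < D ∧ c 1 ^ D = 1 := by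
    refine exists_pow_eq_one_of_pow_eq_pow h1 hde ?_
    refine mul_left_cancel₀ (pow_ne_zero (d 0 * e 0) h0) ?_
    calc _ = (c 0 ^ d 0 * c 1 ^ d 1) ^ e 0 := by ring
      _ = (c 0 ^ e 0 * c 1 ^ e 1) ^ d 0 := by rw [hd, he, one_pow, one_pow]
      _ = _ := by ring
  by_contra hf0
  have h2 := hf (D₀ * D₁) (by positivity) ((D₀ * D₁) • MonomialOrder.lex.degree f) (by
    simp only [monomialEval, Finsupp.smul_apply, smul_eq_mul]
    rw [mul_assoc, pow_mul, hD₀', one_pow, mul_comm D₀, mul_assoc, pow_mul, hD₁', one_pow, one_mul])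
  rw [MonomialOrder.coeff_pow_nsmul_degree] at h2
  exact pow_ne_zero _ (MonomialOrder.lex.leadingCoeff_ne_zero_iff.2 hf0) h2

/-- `avoiding c` is a Mathieu-Zhao subspace. -/
theorem isMZSubspace_avoiding (c : Fin 2 → K) : IsMZSubspace (avoiding c) := by
  intro f b hf
  by_cases h : ∃ d, d ≠ 0 ∧ monomialEval c d = 1
  swap
  · push Not at h
    refine ⟨1, fun m hm d hd ↦ ?_⟩
    obtain rfl : d = 0 := by
      by_contra hd0
      exact h d hd0 hd
    have h0 : coeff 0 f = 0 := by simpa using hf 1 one_pos 0 hd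
    rw [← constantCoeff_eq] at h0 ⊢
    simp [h0, (show m ≠ 0 by omega)]
  obtain ⟨d, hd0, hd⟩ := h
  by_cases hray : ∀ e, monomialEval c e = 1 → d 1 * e 0 = d 0 * e 1
  swap
  · push Not at hray
    obtain ⟨e, he, hne⟩ := hray
    refine ⟨1, fun m hm ↦ ?_⟩
    rw [eq_zero_of_pow_mem_avoiding hd he hne hf, zero_pow (by omega), mul_zero]
    exact zero_mem _
  have hpq : 0 < d 0 + d 1 := by
    by_contra! h
    apply hd0
    ext i
    fin_cases i <;> simp <;> omega
  have hslope (e : Fin 2 →₀ ℕ) (he : monomialEval c e = 1) : slope (d 0) (d 1) e = 0 := by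
    rw [slope_apply, sub_eq_zero]
    exact_mod_cast hray e he
  obtain ⟨w, hw, hfw⟩ : ∃ w : (Fin 2 →₀ ℕ) →+ ℤ, (∀ e, monomialEval c e = 1 → w e = 0) ∧
      ∀ e ∈ f.support, 0 < w e := by
    rcases forall_slope_pos_or_forall_slope_neg hpq hd hf with h | h
    · exact ⟨slope (d 0) (d 1), hslope, h⟩
    · exact ⟨-slope (d 0) (d 1), fun e he ↦ by simp [hslope e he],
        fun e he ↦ by simpa using h e he⟩
  obtain ⟨N, hN⟩ := exists_forall_pos_of_mem_support_mul_pow w f b hfw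
  refine ⟨N, fun m hm e he ↦ ?_⟩
  by_contra hne
  exact (hN m hm e (mem_support_iff.2 hne)).ne' (hw e he)

end MvPolynomial

namespace MvPolynomial
variable {K : Type*} [Field K]

lemma range_id_sub_rescale (c : Fin 2 → K) :
    LinearMap.range (LinearMap.id - (rescale c).toLinearMap) = avoiding c := by
  ext g
  constructor
  · rintro ⟨f, rfl⟩ d hd
    simp [coeff_rescale, hd]
  · intro hg
    rw [g.as_sum]
    refine sum_mem fun d _ ↦ ?_
    by_cases hd : monomialEval c d = 1
    · rw [hg d hd, map_zero]
      exact zero_mem _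
    · refine ⟨monomial d (coeff d g / (1 - monomialEval c d)), ?_⟩
      have : 1 - monomialEval c d ≠ 0 := sub_ne_zero.2 (Ne.symm hd)
      ext e
      rw [LinearMap.sub_apply, LinearMap.id_apply, AlgHom.toLinearMap_apply, coeff_sub,
        coeff_rescale, coeff_monomial, coeff_monomial]
      split_ifs with h
      · subst h
        field_simp
      · simp

section Shear
variable {φ : MvPolynomial (Fin 2) K →ₐ[K] MvPolynomial (Fin 2) K} {a ν : K}

lemma map_X_pow_mul_X_pow (h0 : φ (X 0) = a • X 0) (h1 : φ (X 1) = ν • X 0 + a • X 1) (i n : ℕ) :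
    φ (X 0 ^ i * X 1 ^ n) = ∑ m ∈ Finset.range (n + 1),
      (a ^ (i + m) * ν ^ (n - m) * n.choose m) • (X 0 ^ (i + (n - m)) * X 1 ^ m) := by
  rw [map_mul, map_pow, map_pow, h0, h1, add_comm (ν • _), add_pow, Finset.mul_sum]
  refine Finset.sum_congr rfl fun m _ ↦ ?_
  simp only [smul_eq_C_mul, map_mul, map_pow, map_natCast]
  ring

variable [CharZero K]

lemma X_pow_mul_X_pow_mem_range (h0 : φ (X 0) = a • X 0) (h1 : φ (X 1) = ν • X 0 + a • X 1)
    (hν : ν ≠ 0) (i n : ℕ) (h : 0 < i ∨ a ^ n ≠ 1) :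
    (X 0 ^ i * X 1 ^ n : MvPolynomial (Fin 2) K) ∈
      LinearMap.range (LinearMap.id - φ.toLinearMap) := by
  induction n using Nat.strong_induction_on generalizing i with
  | _ n ih =>
  by_cases ha : a ^ (i + n) = 1
  · obtain ⟨i, rfl⟩ : ∃ i', i = i' + 1 := by
      refine ⟨i - 1, ?_⟩
      rcases h with h | h
      · omega
      · have : i ≠ 0 := by rintro rfl; simp [h] at ha
        omega
    have ha0 : a ≠ 0 := by rintro rfl; simp at ha
    have h2 := map_X_pow_mul_X_pow h0 h1 i (n + 1)
    rw [Finset.sum_range_succ, Finset.sum_range_succ, Nat.sub_self, pow_zero, add_zero, mul_one,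
      Nat.choose_self, Nat.cast_one, mul_one, show i + (n + 1) = i + 1 + n by ring, ha, one_smul,
      Nat.choose_succ_self_right, show n + 1 - n = 1 by omega, pow_one] at h2
    have hc : a ^ (i + n) * ν * ((n + 1 : ℕ) : K) ≠ 0 :=
      mul_ne_zero (mul_ne_zero (pow_ne_zero _ ha0) hν) (Nat.cast_ne_zero.2 n.succ_ne_zero)
    rw [← Submodule.smul_mem_iff _ hc]
    have h3 := neg_mem (LinearMap.mem_range_self (LinearMap.id - φ.toLinearMap)
      (X 0 ^ i * X 1 ^ (n + 1)))
    rw [LinearMap.sub_apply, LinearMap.id_apply, AlgHom.toLinearMap_apply, h2] at h3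
    refine (Submodule.add_mem_iff_right _ (Submodule.sum_mem _ fun m hm ↦
      Submodule.smul_mem _ _ (ih m (Finset.mem_range.1 hm) _ (Or.inl ?_)))).1
      (by convert h3 using 1; ring)
    have := Finset.mem_range.1 hm
    omega
  · have h2 := map_X_pow_mul_X_pow h0 h1 i n
    rw [Finset.sum_range_succ, Nat.sub_self, pow_zero, add_zero, mul_one, Nat.choose_self,
      Nat.cast_one, mul_one] at h2
    rw [← Submodule.smul_mem_iff _ (sub_ne_zero.2 (Ne.symm ha)), sub_smul, one_smul]
    have h3 := LinearMap.mem_range_self (LinearMap.id - φ.toLinearMap) (X 0 ^ i * X 1 ^ n)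
    rw [LinearMap.sub_apply, LinearMap.id_apply, AlgHom.toLinearMap_apply, h2] at h3
    refine (Submodule.sub_mem_iff_left _ (Submodule.sum_mem _ fun m hm ↦
      Submodule.smul_mem _ _ (ih m (Finset.mem_range.1 hm) _ (Or.inl ?_)))).1
      (by convert h3 using 1; ring)
    have := Finset.mem_range.1 hm
    omega

lemma range_id_sub_shear (h0 : φ (X 0) = a • X 0) (h1 : φ (X 1) = ν • X 0 + a • X 1)
    (hν : ν ≠ 0) :
    LinearMap.range (LinearMap.id - φ.toLinearMap) = avoiding ![0, a] := by
  have eval_eq_one {d : Fin 2 →₀ ℕ} (hd : monomialEval ![0, a] d = 1) :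
      d 0 = 0 ∧ a ^ d 1 = 1 := by
    simp only [monomialEval, Matrix.cons_val_zero, Matrix.cons_val_one] at hd
    have h : d 0 = 0 := by
      by_contra h
      simp [h] at hd
    exact ⟨h, by simpa [h] using hd⟩
  ext g
  constructor
  · rintro ⟨f, rfl⟩ d hd
    obtain ⟨hd0, hd1⟩ := eval_eq_one hd
    have hcomp : (rescale ![0, 1]).comp φ = rescale ![0, a] := by
      refine algHom_ext fun i ↦ ?_
      fin_cases i <;> simp [h0, h1, rescale]
    have h2 := congrArg (coeff d) (DFunLike.congr_fun hcomp f)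
    rw [AlgHom.comp_apply, coeff_rescale, coeff_rescale, hd] at h2
    simp only [monomialEval, hd0, Matrix.cons_val_one, Matrix.cons_val_zero, one_pow, pow_zero,
      one_mul] at h2
    simp [h2]
  · intro hg
    rw [g.as_sum]
    refine sum_mem fun d _ ↦ ?_
    rw [monomial_eq, Finsupp.prod_fintype _ _ (by simp), Fin.prod_univ_two, ← smul_eq_C_mul]
    by_cases hd : monomialEval ![0, a] d = 1
    · rw [hg d hd, zero_smul]
      exact zero_mem _
    · refine Submodule.smul_mem _ _ (X_pow_mul_X_pow_mem_range h0 h1 hν _ _ ?_)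
      by_contra! h
      exact hd (by simp [monomialEval, Nat.le_zero.1 h.1, h.2])

end Shear
end MvPolynomial

lemma IsMZSubspace.of_ringHom {k k' R R' : Type*} [CommRing k] [CommRing k'] [CommRing R]
    [CommRing R'] [Algebra k R] [Algebra k' R'] {M : Submodule k R} {M' : Submodule k' R'}
    (t : R →+* R') (h : ∀ f, f ∈ M ↔ t f ∈ M') (hM' : IsMZSubspace M') : IsMZSubspace M := by
  intro a b ha
  obtain ⟨N, hN⟩ := hM' (t a) (t b) fun m hm ↦ by
    rw [← map_pow]
    exact (h _).1 (ha m hm)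
  exact ⟨N, fun m hm ↦ (h _).2 (by rw [map_mul, map_pow]; exact hN m hm)⟩

lemma isMZSubspace_range_of_conj {k R : Type*} [CommRing k] [CommRing R] [Algebra k R]
    (φ s t : R →ₐ[k] R) (hst : s.comp t = AlgHom.id k R)
    (hts : t.comp s = AlgHom.id k R)
    (h : IsMZSubspace (LinearMap.range (LinearMap.id - (t.comp (φ.comp s)).toLinearMap))) :
    IsMZSubspace (LinearMap.range (LinearMap.id - φ.toLinearMap)) := by
  have hst' (x : R) : s (t x) = x := DFunLike.congr_fun hst x
  have hts' (x : R) : t (s x) = x := DFunLike.congr_fun hts x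
  refine IsMZSubspace.of_ringHom t.toRingHom (fun f ↦ ⟨?_, ?_⟩) h
  · rintro ⟨g, rfl⟩
    exact ⟨t g, by simp [hst']⟩
  · rintro ⟨g, hg⟩
    refine ⟨s g, ?_⟩
    simpa [hst'] using congrArg s hg

namespace MvPolynomial
variable {K : Type*} [Field K]

/-- The linear substitution with matrix `A`. -/
noncomputable def linSubst (A : Matrix (Fin 2) (Fin 2) K) :
    MvPolynomial (Fin 2) K →ₐ[K] MvPolynomial (Fin 2) K :=
  aeval fun i ↦ ∑ j, A i j • X j

lemma linSubst_X (A : Matrix (Fin 2) (Fin 2) K) (i : Fin 2) :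
    linSubst A (X i) = ∑ j, A i j • X j := by
  simp [linSubst]

lemma linSubst_one : linSubst (1 : Matrix (Fin 2) (Fin 2) K) = AlgHom.id K _ := by
  refine algHom_ext fun i ↦ ?_
  simp [linSubst_X, Matrix.one_apply]

lemma linSubst_comp (A B : Matrix (Fin 2) (Fin 2) K) :
    (linSubst A).comp (linSubst B) = linSubst (B * A) := by
  refine algHom_ext fun i ↦ ?_
  simp only [AlgHom.comp_apply, linSubst_X, map_sum, map_smul, Matrix.mul_apply, Finset.smul_sum,
    smul_smul, Finset.sum_smul]
  exact Finset.sum_comm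

lemma isMZSubspace_range_linSubst_of_conj {A P Q : Matrix (Fin 2) (Fin 2) K} (hPQ : P * Q = 1)
    (h : IsMZSubspace (LinearMap.range (LinearMap.id - (linSubst (P * A * Q)).toLinearMap))) :
    IsMZSubspace (LinearMap.range (LinearMap.id - (linSubst A).toLinearMap)) := by
  refine isMZSubspace_range_of_conj _ (linSubst P) (linSubst Q) ?_ ?_ ?_
  · rw [linSubst_comp, mul_eq_one_comm.1 hPQ, linSubst_one]
  · rw [linSubst_comp, hPQ, linSubst_one]
  · rwa [linSubst_comp, linSubst_comp]

lemma map_linSubst {L : Type*} [Field L] (i : K →+* L) (A : Matrix (Fin 2) (Fin 2) K)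
    (f : MvPolynomial (Fin 2) K) : map i (linSubst A f) = linSubst (A.map i) (map i f) := by
  induction f using MvPolynomial.induction_on with
  | C a => simp [linSubst]
  | add p q hp hq => simp only [map_add, hp, hq]
  | mul_X p n hp =>
    simp only [map_mul, hp, map_X, linSubst_X, map_sum, smul_eq_C_mul, map_C, Matrix.map_apply]

/-- Membership in the image of `id - φ` descends along field extensions. -/
lemma mem_range_of_map_mem_range {L : Type*} [Field L] [Algebra K L]
    (A : Matrix (Fin 2) (Fin 2) K) {f : MvPolynomial (Fin 2) K}
    (hf : map (algebraMap K L) f ∈ LinearMap.range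
      (LinearMap.id - (linSubst (A.map (algebraMap K L))).toLinearMap)) :
    f ∈ LinearMap.range (LinearMap.id - (linSubst A).toLinearMap) := by
  obtain ⟨r, hr⟩ := (Algebra.linearMap K L).exists_leftInverse_of_injective
    (LinearMap.ker_eq_bot.2 (algebraMap K L).injective)
  have hr1 (a : L) (b : K) : r (a * algebraMap K L b) = r a * b := by
    rw [mul_comm, ← Algebra.smul_def, map_smul, smul_eq_mul, mul_comm]
  have hr2 (b : K) : r (algebraMap K L b) = b := LinearMap.congr_fun hr b
  let ρ : MvPolynomial (Fin 2) L →+ MvPolynomial (Fin 2) K :=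
    { toFun := AddMonoidAlgebra.map r.toAddMonoidHom
      map_zero' := by ext; simp
      map_add' x y := by ext; simp }
  have coeff_ρ (g : MvPolynomial (Fin 2) L) (d : Fin 2 →₀ ℕ) : coeff d (ρ g) = r (coeff d g) := rfl
  have ρ_mul (a : L) (g : MvPolynomial (Fin 2) K) :
      ρ (C a * map (algebraMap K L) g) = C (r a) * g := by
    ext d
    rw [coeff_ρ, coeff_C_mul, coeff_C_mul, coeff_map, hr1]
  have ρ_map (g : MvPolynomial (Fin 2) K) : ρ (map (algebraMap K L) g) = g := by
    ext d
    rw [coeff_ρ, coeff_map, hr2]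
  have ρ_linSubst (g : MvPolynomial (Fin 2) L) :
      ρ (linSubst (A.map (algebraMap K L)) g) = linSubst A (ρ g) := by
    induction g using MvPolynomial.induction_on' with
    | add p q hp hq => simp only [map_add, hp, hq]
    | monomial d a =>
      have h1 : monomial d a = C a * map (algebraMap K L) (monomial d 1) := by
        rw [map_monomial, C_mul_monomial, map_one, mul_one]
      rw [h1, ρ_mul, map_mul, ← map_linSubst, ← algebraMap_eq, AlgHom.commutes, algebraMap_eq,
        ρ_mul, map_mul, ← algebraMap_eq, AlgHom.commutes, algebraMap_eq]
  obtain ⟨g, hg⟩ := hf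
  refine ⟨ρ g, ?_⟩
  have := congrArg ρ hg
  rw [ρ_map, LinearMap.sub_apply, map_sub] at this
  simpa [ρ_linSubst] using this

lemma isMZSubspace_range_linSubst_of_map {L : Type*} [Field L] [Algebra K L]
    {A : Matrix (Fin 2) (Fin 2) K}
    (h : IsMZSubspace (LinearMap.range
      (LinearMap.id - (linSubst (A.map (algebraMap K L))).toLinearMap))) :
    IsMZSubspace (LinearMap.range (LinearMap.id - (linSubst A).toLinearMap)) := by
  refine IsMZSubspace.of_ringHom (map (algebraMap K L))
    (fun f ↦ ⟨?_, mem_range_of_map_mem_range A⟩) h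
  rintro ⟨g, rfl⟩
  exact ⟨map (algebraMap K L) g, by simp [map_linSubst]⟩

lemma linSubst_eq_rescale (c : Fin 2 → K) : linSubst (Matrix.diagonal c) = rescale c := by
  refine algHom_ext fun i ↦ ?_
  simp [linSubst_X, rescale, Matrix.diagonal_apply]

variable [CharZero K]

lemma isMZSubspace_range_linSubst_of_lower (a ν b : K) :
    IsMZSubspace (LinearMap.range (LinearMap.id - (linSubst !![a, 0; ν, b]).toLinearMap)) := by
  have diag (a b : K) :
      IsMZSubspace (LinearMap.range (LinearMap.id - (linSubst !![a, 0; 0, b]).toLinearMap)) := by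
    rw [show !![a, 0; 0, b] = Matrix.diagonal ![a, b] by
      ext i j; fin_cases i <;> fin_cases j <;> rfl, linSubst_eq_rescale, range_id_sub_rescale]
    exact isMZSubspace_avoiding _
  by_cases hab : a = b
  · subst hab
    by_cases hν : ν = 0
    · subst hν
      exact diag a a
    · rw [range_id_sub_shear (a := a) (by simp [linSubst_X]) (by simp [linSubst_X]) hν]
      exact isMZSubspace_avoiding _
  · have hba : b - a ≠ 0 := sub_ne_zero.2 (Ne.symm hab)
    refine isMZSubspace_range_linSubst_of_conj (P := !![1, 0; ν / (b - a), 1])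
      (Q := !![1, 0; -(ν / (b - a)), 1]) ?_ ?_
    · ext i j; fin_cases i <;> fin_cases j <;> simp
    · have h : !![1, 0; ν / (b - a), 1] * !![a, 0; ν, b] * !![1, 0; -(ν / (b - a)), 1] =
          !![a, 0; 0, b] := by
        ext i j
        fin_cases i <;> fin_cases j <;> simp
        field_simp
        ring
      rw [h]
      exact diag a b

theorem isMZSubspace_range_linSubst (A : Matrix (Fin 2) (Fin 2) K) :
    IsMZSubspace (LinearMap.range (LinearMap.id - (linSubst A).toLinearMap)) := by
  refine isMZSubspace_range_linSubst_of_map (L := AlgebraicClosure K) ?_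
  have : CharZero (AlgebraicClosure K) :=
    charZero_of_injective_algebraMap (algebraMap K (AlgebraicClosure K)).injective
  generalize A.map (algebraMap K (AlgebraicClosure K)) = B
  obtain ⟨a, ha⟩ := Module.End.exists_eigenvalue (Matrix.toLin' B.transpose)
  obtain ⟨v, hv⟩ := ha.exists_hasEigenvector
  have hv0 := hv.2
  have hvB : Matrix.vecMul v B = a • v := by
    simpa [Matrix.mulVec_transpose] using hv.apply_eq_smul
  obtain ⟨P, hP, hPv⟩ : ∃ P : Matrix (Fin 2) (Fin 2) (AlgebraicClosure K),
      IsUnit P.det ∧ P 0 = v := by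
    by_cases h : v 0 = 0
    · refine ⟨Matrix.of ![v, ![1, 0]], ?_, rfl⟩
      have : v 1 ≠ 0 := fun h1 ↦ hv0 (by ext i; fin_cases i <;> simp [h, h1])
      simpa [Matrix.det_fin_two] using this
    · refine ⟨Matrix.of ![v, ![0, 1]], ?_, rfl⟩
      simpa [Matrix.det_fin_two] using h
  refine isMZSubspace_range_linSubst_of_conj (Matrix.mul_nonsing_inv P hP) ?_
  have hrow : (P * B * P⁻¹) 0 = ![a, 0] := by
    have h1 : (P * B) 0 = a • P 0 := by rw [Matrix.mul_apply_eq_vecMul, hPv, hvB]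
    have h2 : (P * P⁻¹) 0 = ![1, 0] := by
      rw [Matrix.mul_nonsing_inv P hP]
      ext i; fin_cases i <;> simp [Matrix.one_apply]
    rw [Matrix.mul_apply_eq_vecMul, h1, Matrix.smul_vecMul, ← Matrix.mul_apply_eq_vecMul, h2]
    simp
  have hlower : P * B * P⁻¹ = !![a, 0; (P * B * P⁻¹) 1 0, (P * B * P⁻¹) 1 1] := by
    ext i j
    fin_cases i
    · exact (congrFun hrow j).trans (by fin_cases j <;> rfl)
    · fin_cases j <;> rfl
  rw [hlower]
  exact isMZSubspace_range_linSubst_of_lower _ _ _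

end MvPolynomial

theorem image_of_linear_E_derivation_is_MZ_two_vars
    {K : Type*} [Field K] [CharZero K]
    (φ : MvPolynomial (Fin 2) K →ₐ[K] MvPolynomial (Fin 2) K)
    (hφ : ∀ i : Fin 2, ∃ c : Fin 2 → K,
      φ (MvPolynomial.X i) = ∑ j : Fin 2, c j • MvPolynomial.X j)
    (δ : MvPolynomial (Fin 2) K →ₗ[K] MvPolynomial (Fin 2) K)
    (hδ : δ = LinearMap.id - φ.toLinearMap) :
    IsMZSubspace (LinearMap.range δ) := by
  subst hδ
  choose c hc using hφ
  have : φ = MvPolynomial.linSubst (Matrix.of c) :=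
    MvPolynomial.algHom_ext fun i ↦ by rw [hc, MvPolynomial.linSubst_X]; rfl
  rw [this]
  exact MvPolynomial.isMZSubspace_range_linSubst _
end

section
/- Let K be a field of characteristic zero, m a positive integer, and a ∈ K a primitive m-th root of unity. Let φ_a be the K-algebra endomorphism of R = K[x1,x2,x3] defined by φ_a(x1) = a·x1, φ_a(x2) = a·x1 + a·x2, φ_a(x3) = −(1/2)·a·x1 − a·x2 + a·x3, and let δ_a = id − φ_a. If f ∈ R satisfies f^i ∈ im δ_a for all positive integers i, then deg_ω f < 0, where deg_ω denotes the weighted degree with weight vector ω = (−1,0,1). -/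
open MvPolynomial

/-- The weighted degree of a polynomial in `K[x₁,x₂,x₃]` with respect to the weight
vector `ω = (-1, 0, 1)`; it is `-∞` (i.e. `⊥`) on the zero polynomial. -/
noncomputable def degOmega {K : Type*} [Field K] (f : MvPolynomial (Fin 3) K) : WithBot ℤ :=
  f.support.sup fun β => ((-(β 0 : ℤ) + (β 2 : ℤ) : ℤ) : WithBot ℤ)

open Polynomial in
/-- The integrals over `[-1, 1]` of the positive powers of a nonzero polynomial with algebraic
coefficients cannot all vanish. -/
theorem false_of_sum_coeff_pow_eq_zero_of_algebraic {L : Type*} [Field L] [Algebra ℚ L]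
    [Algebra.IsAlgebraic ℚ L] (P : L[X]) (n : ℕ)
    (hdeg : P.natDegree ≤ n) (hlead : P.coeff n ≠ 0)
    (h : ∀ j : ℕ, 0 < j → ∑ k ∈ Finset.range (j * n + 1),
      ((1 + (-1) ^ k) / (k + 1) : ℚ) • (P ^ j).coeff k = 0) : False := by
  have : CharZero L := algebraRat.charZero L
  rcases Nat.eq_zero_or_pos n with rfl | hn
  · have := h 1 one_pos
    simp [hlead] at this
  have hfin : ∃ d : ℤ, d ≠ 0 ∧ ∀ x ∈ insert (P.coeff n)⁻¹ (P.coeffs : Set L),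
      IsIntegral ℤ (d • x) := by
    have : Algebra.IsAlgebraic ℤ L :=
      (IsFractionRing.comap_isAlgebraic_iff (A := ℤ) (K := ℚ) (C := L)).mpr inferInstance
    classical
    obtain ⟨d, hd0, hd⟩ :=
      Algebra.IsAlgebraic.exists_integral_multiples ℤ (insert (P.coeff n)⁻¹ P.coeffs)
    exact ⟨d, hd0, fun x hx => hd x (by simpa using hx)⟩
  obtain ⟨d, hd0, hd⟩ := hfin
  obtain ⟨p, hp, hpgt, hpmod⟩ := Nat.exists_prime_gt_modEq_one (k := n) (max 2 d.natAbs) hn.ne'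
  have hp2 : 2 < p := lt_of_le_of_lt (le_max_left _ _) hpgt
  have hpd : d.natAbs < p := lt_of_le_of_lt (le_max_right _ _) hpgt
  obtain ⟨i, hi⟩ : n ∣ p - 1 := (Nat.modEq_iff_dvd' hp.one_le).mp hpmod.symm
  have hi0 : 0 < i := by
    rcases Nat.eq_zero_or_pos i with rfl | h'
    · omega
    · exact h'
  have hin : i * n + 1 = p := by rw [mul_comm, ← hi]; omega
  have h_integral : ∀ k, IsIntegral ℤ ((d : L) ^ i * (P ^ i).coeff k) := by
    have hl : Polynomial.C (d : L) * P ∈ lifts (algebraMap (integralClosure ℤ L) L) := by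
      rw [Polynomial.lifts_iff_coeff_lifts]
      intro k
      rw [Polynomial.coeff_C_mul]
      by_cases hk : P.coeff k = 0
      · exact ⟨0, by simp [hk]⟩
      · have := hd (P.coeff k) (Set.mem_insert_of_mem _ (Polynomial.coeff_mem_coeffs hk))
        rw [zsmul_eq_mul] at this
        exact ⟨⟨_, this⟩, rfl⟩
    intro k
    have h2 := Subsemiring.pow_mem _ hl i
    rw [mul_pow, ← Polynomial.C_pow, Polynomial.lifts_iff_coeff_lifts] at h2
    obtain ⟨y, hy⟩ := h2 k
    rw [Polynomial.coeff_C_mul] at hy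
    rw [← hy]
    exact y.2
  have hsum := h i hi0
  rw [Finset.sum_range_succ, coeff_pow_of_natDegree_le hdeg] at hsum
  have hpL : (p : L) ≠ 0 := Nat.cast_ne_zero.mpr hp.ne_zero
  have heven : Even (i * n) := by
    have := hp.even_sub_one hp2.ne'
    rwa [hi, mul_comm] at this
  have hlast : ((1 + (-1) ^ (i * n)) / ((i * n : ℕ) + 1) : ℚ) = 2 / p := by
    rw [heven.neg_one_pow, ← hin]; push_cast; norm_num
  rw [hlast] at hsum
  obtain ⟨W, hWint, hW⟩ : ∃ W : L, IsIntegral ℤ W ∧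
      (p : L) * W = -(2 * ((p - 1).factorial : L) * (d : L) ^ (2 * i)) := by
    refine ⟨((d : L) * (P.coeff n)⁻¹) ^ i * ∑ k ∈ Finset.range (i * n),
      ((((p - 1).factorial / (k + 1) : ℕ) * (1 + (-1) ^ k) : ℤ) : L) *
        ((d : L) ^ i * (P ^ i).coeff k), ?_, ?_⟩
    · refine IsIntegral.mul (IsIntegral.pow ?_ _) (IsIntegral.sum _ fun k _ => ?_)
      · simpa [zsmul_eq_mul] using hd _ (Set.mem_insert _ _)
      · exact (isIntegral_algebraMap (R := ℤ) (A := L)).mul (h_integral k)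
    · have hterm : ∀ k ∈ Finset.range (i * n),
          ((((p - 1).factorial / (k + 1) : ℕ) * (1 + (-1) ^ k) : ℤ) : L) *
            ((d : L) ^ i * (P ^ i).coeff k) =
          ((p - 1).factorial : L) * (d : L) ^ i *
            (((1 + (-1) ^ k) / (k + 1) : ℚ) • (P ^ i).coeff k) := by
        intro k hk
        obtain ⟨q, hq⟩ : k + 1 ∣ (p - 1).factorial :=
          Nat.dvd_factorial (Nat.succ_pos _) (by have := Finset.mem_range.mp hk; omega)
        have hk0 : ((k + 1 : ℕ) : L) ≠ 0 := Nat.cast_ne_zero.mpr (Nat.succ_ne_zero k)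
        rw [hq, Nat.mul_div_cancel_left _ (Nat.succ_pos k), Algebra.smul_def]
        rw [Nat.cast_succ] at hk0
        simp only [map_div₀, map_add, map_one, map_pow, map_neg, map_natCast]
        push_cast
        field_simp
      rw [Finset.sum_congr rfl hterm, ← Finset.mul_sum, eq_neg_of_add_eq_zero_left hsum,
        Algebra.smul_def]
      simp only [map_div₀, map_natCast, map_ofNat]
      rw [mul_pow, inv_pow]
      have := pow_ne_zero i hlead
      field_simp
      ring
  have hWq : W = algebraMap ℚ L (-(2 * ((p - 1).factorial : ℚ) * (d : ℚ) ^ (2 * i)) / p) := by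
    simp only [map_div₀, map_natCast, map_ofNat, map_neg, map_mul, map_pow, map_intCast]
    rw [eq_div_iff hpL, mul_comm, hW]
  rw [hWq, isIntegral_algebraMap_iff (algebraMap ℚ L).injective] at hWint
  obtain ⟨z, hz⟩ := IsIntegrallyClosed.isIntegral_iff.mp hWint
  have hz' : (p : ℤ) * z = -(2 * ((p - 1).factorial : ℤ) * d ^ (2 * i)) := by
    have hpQ : (p : ℚ) ≠ 0 := Nat.cast_ne_zero.mpr hp.ne_zero
    rw [eq_div_iff hpQ] at hz
    simp only [eq_intCast] at hz
    exact_mod_cast (mul_comm _ _).trans hz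
  have hpp : Prime (p : ℤ) := Nat.prime_iff_prime_int.mp hp
  have hdvd : (p : ℤ) ∣ 2 * ((p - 1).factorial : ℤ) * d ^ (2 * i) :=
    (dvd_neg.mp (hz' ▸ dvd_mul_right _ _))
  rcases hpp.dvd_or_dvd hdvd with h1 | h1
  · rcases hpp.dvd_or_dvd h1 with h2 | h2
    · have := Nat.le_of_dvd two_pos (by exact_mod_cast h2)
      omega
    · have := (hp.dvd_factorial).mp (by exact_mod_cast h2)
      have := hp.one_lt
      omega
  · have h2 := hpp.dvd_of_dvd_pow h1
    have := Nat.le_of_dvd (Int.natAbs_pos.mpr hd0) (Int.natCast_dvd.mp h2)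
    omega

/-- A nontrivial finitely generated algebra over a field maps to an algebraic extension. -/
theorem exists_algHom_algebraic.{u, v} (k : Type u) (B : Type v) [Field k] [CommRing B]
    [Nontrivial B] [Algebra k B]
    [Algebra.FiniteType k B] : ∃ (L : Type v) (_ : Field L) (_ : Algebra k L),
      Algebra.IsAlgebraic k L ∧ Nonempty (B →ₐ[k] L) := by
  obtain ⟨M, hM⟩ := Ideal.exists_maximal B
  let : Field (B ⧸ M) := Ideal.Quotient.field M
  have : Algebra.FiniteType k (B ⧸ M) := inferInstance
  have : Module.Finite k (B ⧸ M) := finite_of_finite_type_of_isJacobsonRing k (B ⧸ M)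
  exact ⟨B ⧸ M, inferInstance, inferInstance, inferInstance, ⟨Ideal.Quotient.mkₐ k M⟩⟩

open Polynomial in
/-- The integrals over `[-1, 1]` of the positive powers of a nonzero polynomial over a field of
characteristic zero cannot all vanish. -/
theorem false_of_sum_coeff_pow_eq_zero {K : Type*} [Field K] [CharZero K] (P : K[X]) (hP : P ≠ 0)
    (h : ∀ j : ℕ, 0 < j → ∑ k ∈ Finset.range (j * P.natDegree + 1),
      ((1 + (-1) ^ k) / (k + 1) : ℚ) • (P ^ j).coeff k = 0) : False := by
  classical
  set n := P.natDegree
  have hlc : P.leadingCoeff ≠ 0 := leadingCoeff_ne_zero.mpr hP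
  let S : Finset K := insert (P.leadingCoeff)⁻¹ P.coeffs
  let B := Algebra.adjoin ℚ (S : Set K)
  have hB : Algebra.FiniteType ℚ B := (Subalgebra.fg_iff_finiteType _).mp ⟨S, rfl⟩
  have hlift : P ∈ lifts (algebraMap B K) := by
    rw [Polynomial.lifts_iff_coeff_lifts]
    intro k
    by_cases hk : P.coeff k = 0
    · exact ⟨0, by simp [hk]⟩
    · exact ⟨⟨_, Algebra.subset_adjoin
        (Finset.mem_coe.mpr (Finset.mem_insert_of_mem (Polynomial.coeff_mem_coeffs hk)))⟩, rfl⟩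
  obtain ⟨Q, hQ⟩ := (Polynomial.mem_lifts _).mp hlift
  have hinj : Function.Injective (algebraMap B K) := Subtype.val_injective
  obtain ⟨L, _, _, _, ⟨π⟩⟩ := exists_algHom_algebraic ℚ B
  have hcoeff : ∀ j k, algebraMap B K ((Q ^ j).coeff k) = (P ^ j).coeff k := by
    intro j k
    rw [← Polynomial.coeff_map, Polynomial.map_pow, hQ]
  have hunit : IsUnit (Q.coeff n) := by
    refine IsUnit.of_mul_eq_one ⟨(P.leadingCoeff)⁻¹, Algebra.subset_adjoin (by simp [S])⟩ (hinj ?_)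
    have := hcoeff 1 n
    rw [pow_one, pow_one] at this
    rw [map_mul, this, map_one]
    exact mul_inv_cancel₀ hlc
  refine false_of_sum_coeff_pow_eq_zero_of_algebraic (Q.map (π : B →+* L)) n ?_ ?_ ?_
  · refine natDegree_map_le.trans ?_
    rw [← natDegree_map_eq_of_injective hinj, hQ]
  · rw [Polynomial.coeff_map]
    exact (hunit.map _).ne_zero
  · intro j hj
    have hB0 : ∑ k ∈ Finset.range (j * n + 1),
      ((1 + (-1) ^ k) / (k + 1) : ℚ) • (Q ^ j).coeff k = 0 := by
      apply hinj
      rw [map_sum, map_zero, ← h j hj]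
      refine Finset.sum_congr rfl fun k _ => ?_
      rw [← hcoeff]
      exact map_smul (IsScalarTower.toAlgHom ℚ B K) _ _
    rw [← map_zero π, ← hB0, map_sum]
    refine Finset.sum_congr rfl fun k _ => ?_
    rw [map_smul, ← Polynomial.map_pow, Polynomial.coeff_map]
    rfl

open Polynomial in
theorem eq_zero_of_forall_pow_eq_derivative {K : Type*} [Field K] [CharZero K] (P : K[X])
    (h : ∀ j : ℕ, 0 < j → ∃ F : K[X], derivative F = P ^ j ∧ F.eval 1 = F.eval (-1)) : P = 0 := by
  by_contra hP
  refine false_of_sum_coeff_pow_eq_zero P hP fun j hj => ?_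
  obtain ⟨F, hF, hev⟩ := h j hj
  have hdeg : F.natDegree < j * P.natDegree + 1 + 1 := by
    have := natDegree_derivative F
    rw [hF, natDegree_pow] at this
    omega
  rw [eval_eq_sum_range' hdeg, eval_eq_sum_range' hdeg, Finset.sum_range_succ',
    Finset.sum_range_succ' _ (j * P.natDegree + 1)] at hev
  simp only [one_pow, mul_one, pow_zero, add_left_inj] at hev
  rw [← sub_eq_zero, ← Finset.sum_sub_distrib] at hev
  rw [← hev]
  refine Finset.sum_congr rfl fun k _ => ?_
  rw [← hF, coeff_derivative, Algebra.smul_def]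
  have : (k + 1 : K) ≠ 0 := by exact_mod_cast Nat.succ_ne_zero k
  simp only [map_div₀, map_add, map_one, map_pow, map_neg, map_natCast]
  field_simp
  ring

theorem weightedHomogeneousComponent_comm {σ R M N : Type*} [CommSemiring R]
    [AddCommMonoid M] [AddCommMonoid N] (w : σ → M) (v : σ → N) (a : M) (b : N)
    (f : MvPolynomial σ R) :
    weightedHomogeneousComponent w a (weightedHomogeneousComponent v b f) =
      weightedHomogeneousComponent v b (weightedHomogeneousComponent w a f) := by
  classical
  ext s
  simp only [coeff_weightedHomogeneousComponent]
  split_ifs <;> rfl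

section LeadingComponents

variable {σ R M : Type*} [CommRing R]
  [AddCommMonoid M] [LinearOrder M] [IsOrderedCancelAddMonoid M]

theorem weightedHomogeneousComponent_add_mul (w : σ → M) {a b : M} {f g : MvPolynomial σ R}
    (hf : ∀ s ∈ f.support, Finsupp.weight w s ≤ a) (hg : ∀ s ∈ g.support, Finsupp.weight w s ≤ b) :
    weightedHomogeneousComponent w (a + b) (f * g) =
      weightedHomogeneousComponent w a f * weightedHomogeneousComponent w b g := by
  classical
  ext s
  rw [coeff_weightedHomogeneousComponent, coeff_mul, coeff_mul]
  have hterm : ∀ x ∈ Finset.HasAntidiagonal.antidiagonal s,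
      coeff x.1 (weightedHomogeneousComponent w a f) *
        coeff x.2 (weightedHomogeneousComponent w b g) =
      if Finsupp.weight w s = a + b then coeff x.1 f * coeff x.2 g else 0 := by
    rintro ⟨x, y⟩ hxy
    obtain rfl := Finset.HasAntidiagonal.mem_antidiagonal.mp hxy
    simp only [coeff_weightedHomogeneousComponent, map_add]
    by_cases hx : coeff x f = 0
    · simp [hx]
    by_cases hy : coeff y g = 0
    · simp [hy]
    have h1 := hf x (mem_support_iff.mpr hx)
    have h2 := hg y (mem_support_iff.mpr hy)
    have := add_eq_add_iff_eq_and_eq h1 h2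
    by_cases ha : Finsupp.weight w x = a <;> by_cases hb : Finsupp.weight w y = b <;>
      simp [this, ha, hb]
  rw [Finset.sum_congr rfl hterm]
  split_ifs <;> simp

theorem weightedHomogeneousComponent_nsmul_pow (w : σ → M) {a : M} {f : MvPolynomial σ R}
    (hf : ∀ s ∈ f.support, Finsupp.weight w s ≤ a) (j : ℕ) :
    weightedHomogeneousComponent w (j • a) (f ^ j) = weightedHomogeneousComponent w a f ^ j ∧
      ∀ s ∈ (f ^ j).support, Finsupp.weight w s ≤ j • a := by
  classical
  induction j with
  | zero =>
    constructor
    · rw [zero_smul, pow_zero, pow_zero]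
      exact (isWeightedHomogeneous_one R w).weightedHomogeneousComponent_same
    · intro s hs
      have := (isWeightedHomogeneous_one R w) (mem_support_iff.mp (by simpa using hs))
      simp [this]
  | succ j ih =>
    refine ⟨?_, fun s hs => ?_⟩
    · rw [succ_nsmul, pow_succ, weightedHomogeneousComponent_add_mul w ih.2 hf, ih.1, pow_succ]
    · rw [pow_succ] at hs
      obtain ⟨x, hx, y, hy, rfl⟩ := Finset.mem_add.mp (support_mul _ _ hs)
      rw [map_add, succ_nsmul]
      exact add_le_add (ih.2 x hx) (hf y hy)

theorem exists_weightedHomogeneousComponent_ne_zero {M : Type*} [AddCommMonoid M] [LinearOrder M]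
    (w : σ → M) {f : MvPolynomial σ R} (hf : f ≠ 0) :
    ∃ a, weightedHomogeneousComponent w a f ≠ 0 ∧ ∀ s ∈ f.support, Finsupp.weight w s ≤ a := by
  classical
  obtain ⟨c, hc, hmax⟩ := f.support.exists_max_image (Finsupp.weight w) (support_nonempty.mpr hf)
  refine ⟨_, fun h0 => mem_support_iff.mp hc ?_, hmax⟩
  have := congrArg (coeff c) h0
  rwa [coeff_weightedHomogeneousComponent, if_pos rfl, coeff_zero] at this

end LeadingComponents

section Lowering

variable {K : Type*} [Field K]

/-- The weights `(-1, 0, 1)`. -/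
def wt : Fin 3 → ℤ := ![-1, 0, 1]

theorem weight_wt (s : Fin 3 →₀ ℕ) : Finsupp.weight wt s = -(s 0 : ℤ) + s 2 := by
  rw [Finsupp.weight_apply, Finsupp.sum_fintype _ _ (by simp), Fin.sum_univ_three]
  simp [wt]

/-- The locally nilpotent derivation `x₁ ∂₂ - x₂ ∂₃`. -/
noncomputable def lowering (K : Type*) [Field K] :
    Derivation K (MvPolynomial (Fin 3) K) (MvPolynomial (Fin 3) K) :=
  (X 0 : MvPolynomial (Fin 3) K) • pderiv 1 - (X 1 : MvPolynomial (Fin 3) K) • pderiv 2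

theorem lowering_apply (u : MvPolynomial (Fin 3) K) :
    lowering K u = X 0 * pderiv 1 u - X 1 * pderiv 2 u := rfl

theorem lowering_isWeightedHomogeneous {u : MvPolynomial (Fin 3) K} {n : ℤ}
    (hu : IsWeightedHomogeneous wt u (n + 1)) : IsWeightedHomogeneous wt (lowering K u) n := by
  rw [lowering_apply]
  refine IsWeightedHomogeneous.sub ?_ ?_
  · have := (isWeightedHomogeneous_X K wt 0).mul (hu.pderiv (i := 1) (n' := n + 1) (by simp [wt]))
    rwa [show wt 0 + (n + 1) = n by simp [wt]] at this
  · have := (isWeightedHomogeneous_X K wt 1).mul (hu.pderiv (i := 2) (n' := n) (by simp [wt]))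
    rwa [show wt 1 + n = n by simp [wt]] at this

theorem weightedHomogeneousComponent_lowering (n : ℤ) (u : MvPolynomial (Fin 3) K) :
    weightedHomogeneousComponent wt n (lowering K u) =
      lowering K (weightedHomogeneousComponent wt (n + 1) u) := by
  classical
  induction u using MvPolynomial.induction_on' with
  | monomial s c =>
    have h := isWeightedHomogeneous_monomial wt s c (sub_add_cancel _ (1 : ℤ)).symm
    rw [weightedHomogeneousComponent_of_mem h,
      weightedHomogeneousComponent_of_mem (lowering_isWeightedHomogeneous h)]
    by_cases hn : n = Finsupp.weight wt s - 1
    · simp [hn]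
    · have hn' : n + 1 ≠ Finsupp.weight wt s := fun h => hn (eq_sub_of_add_eq h)
      simp [hn, hn']
  | add p q hp hq => simp only [map_add, hp, hq]

theorem lowering_X_zero_pow_mul (k : ℕ) (u : MvPolynomial (Fin 3) K) :
    lowering K (X 0 ^ k * u) = X 0 ^ k * lowering K u := by
  have : lowering K (X 0 ^ k) = 0 := by
    simp [lowering_apply, pderiv_X, Derivation.leibniz_pow]
  rw [Derivation.leibniz, this]
  simp

/-- The exponential of `lowering K`. -/
noncomputable def expLowering (K : Type*) [Field K] :
    MvPolynomial (Fin 3) K →ₐ[K] MvPolynomial (Fin 3) K :=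
  aeval ![X 0, X 0 + X 1, -(C (1 / 2) * X 0) - X 1 + X 2]

/-- The flow `exp (t • lowering K)`, with `t` the polynomial variable. -/
noncomputable def flow (K : Type*) [Field K] :
    MvPolynomial (Fin 3) K →ₐ[K] Polynomial (MvPolynomial (Fin 3) K) :=
  aeval ![.C (X 0), .X * .C (X 0) + .C (X 1),
    .monomial 2 (-(C (1 / 2) * X 0)) - .monomial 1 (X 1) + .C (X 2)]

theorem coeff_derivative_mul_of_derivation {A : Type*} [CommRing A] [Algebra K A]
    (D : Derivation K A A) {P Q : Polynomial A}
    (hP : ∀ k, (Polynomial.derivative P).coeff k = D (P.coeff k))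
    (hQ : ∀ k, (Polynomial.derivative Q).coeff k = D (Q.coeff k)) (k : ℕ) :
    (Polynomial.derivative (P * Q)).coeff k = D ((P * Q).coeff k) := by
  rw [Polynomial.derivative_mul, Polynomial.coeff_add, Polynomial.coeff_mul, Polynomial.coeff_mul,
    Polynomial.coeff_mul, map_sum, ← Finset.sum_add_distrib]
  refine Finset.sum_congr rfl fun x _ => ?_
  rw [hP, hQ, Derivation.leibniz, smul_eq_mul, smul_eq_mul]
  ring

theorem derivative_flow [CharZero K] (u : MvPolynomial (Fin 3) K) (k : ℕ) :
    (Polynomial.derivative (flow K u)).coeff k = lowering K ((flow K u).coeff k) := by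
  induction u using MvPolynomial.induction_on generalizing k with
  | C a =>
    have : flow K (C a) = Polynomial.C (C a) := by
      simp [flow, Polynomial.algebraMap_apply, MvPolynomial.algebraMap_eq]
    rw [this]
    by_cases hk : k = 0 <;> simp [Polynomial.coeff_C, hk, lowering_apply]
  | add p q hp hq =>
    rw [map_add, Polynomial.derivative_add, Polynomial.coeff_add, hp, hq, Polynomial.coeff_add,
      map_add]
  | mul_X p i hp =>
    rw [map_mul]
    refine coeff_derivative_mul_of_derivation _ hp (fun k => ?_) k
    fin_cases i
    · by_cases hk : k = 0 <;> simp [flow, Polynomial.coeff_C, hk, lowering_apply, pderiv_X]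
    · rcases k with _ | _ | k <;>
        simp [flow, Polynomial.coeff_C, lowering_apply, pderiv_X, Polynomial.coeff_X]
    · have h2 : (C (2⁻¹) : MvPolynomial (Fin 3) K) * 2 = 1 := by
        rw [← map_ofNat C 2, ← C_mul, inv_mul_cancel₀ two_ne_zero, C_1]
      rcases k with _ | _ | k <;>
        simp [flow, Polynomial.coeff_C, lowering_apply, pderiv_X, Polynomial.coeff_monomial]
      · linear_combination (X 0) * h2
      · split_ifs <;> simp [pderiv_X]

theorem expLowering_sub_self_mem_range [CharZero K] (u : MvPolynomial (Fin 3) K) :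
    ∃ v, expLowering K u - u = lowering K v := by
  have h1 : (flow K u).eval 1 = expLowering K u := by
    have : ((Polynomial.aeval (1 : MvPolynomial (Fin 3) K)).restrictScalars K).comp (flow K) =
        expLowering K := by
      ext i
      fin_cases i <;> simp [flow, expLowering]
    rw [← this]
    simp
  have h0 : (flow K u).eval 0 = u := by
    have : ((Polynomial.aeval (0 : MvPolynomial (Fin 3) K)).restrictScalars K).comp (flow K) =
        AlgHom.id K _ := by
      ext i
      fin_cases i <;> simp [flow]
    conv_rhs => rw [← AlgHom.id_apply (R := K) u, ← this]
    simp
  rw [← Polynomial.coeff_zero_eq_eval_zero] at h0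
  rw [Polynomial.eval_eq_sum_range' (Nat.lt_succ_self _), Finset.sum_range_succ', h0] at h1
  refine ⟨∑ k ∈ Finset.range (flow K u).natDegree, ((k + 1 : K)⁻¹) • (flow K u).coeff k, ?_⟩
  rw [← h1, map_sum]
  simp only [one_pow, mul_one, pow_zero, add_sub_cancel_right]
  refine Finset.sum_congr rfl fun k _ => ?_
  have hk : (k + 1 : K) ≠ 0 := by exact_mod_cast Nat.succ_ne_zero k
  rw [Derivation.map_smul, ← derivative_flow, Polynomial.coeff_derivative, eq_inv_smul_iff₀ hk,
    MvPolynomial.smul_eq_C_mul]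
  simp [mul_comm]

end Lowering

section Substitution

variable {K : Type*} [Field K]

theorem isHomogeneous_expLowering {u : MvPolynomial (Fin 3) K} {d : ℕ} (hu : u.IsHomogeneous d) :
    (expLowering K u).IsHomogeneous d := by
  have h0 := isHomogeneous_X K (0 : Fin 3)
  have h1 := isHomogeneous_X K (1 : Fin 3)
  have h2 := isHomogeneous_X K (2 : Fin 3)
  have := hu.aeval (fun i => expLowering K (X i)) (n := 1) (by
    intro i
    fin_cases i
    · simpa [expLowering] using h0
    · simpa [expLowering] using h0.add h1
    · simpa [expLowering] using ((h0.C_mul _).neg.sub h1).add h2)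
  rw [one_mul] at this
  convert this using 1
  exact (DFunLike.congr_fun (aeval_unique (expLowering K)) u)

theorem homogeneousComponent_of_apply_X_eq_smul_expLowering (a : K)
    (φ : MvPolynomial (Fin 3) K →ₐ[K] MvPolynomial (Fin 3) K)
    (hφ : ∀ i, φ (X i) = a • expLowering K (X i)) (e : ℕ) (u : MvPolynomial (Fin 3) K) :
    homogeneousComponent e (φ u) = a ^ e • expLowering K (homogeneousComponent e u) := by
  induction u using MvPolynomial.induction_on' with
  | monomial s c =>
    have hs := isHomogeneous_monomial c (rfl : s.degree = s.degree)
    have hmon : φ (monomial s c) = a ^ s.degree • expLowering K (monomial s c) := by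
      have : φ = (expLowering K).comp (aeval fun i => a • X i) := by
        ext i
        simp [hφ]
      rw [this, AlgHom.comp_apply, ← map_smul, aeval_monomial, Finsupp.prod_fintype _ _ (by simp)]
      congr 1
      rw [monomial_eq, Finsupp.prod_fintype _ _ (by simp), Finsupp.degree_eq_sum]
      simp only [Fin.prod_univ_three, Fin.sum_univ_three, mul_pow, pow_add, algebraMap_eq,
        smul_eq_C_mul, C_mul, C_pow]
      ring
    rw [hmon, map_smul, homogeneousComponent_of_mem hs,
      homogeneousComponent_of_mem (isHomogeneous_expLowering hs)]
    split_ifs with h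
    · rw [h]
    · simp
  | add p q hp hq => simp only [map_add, hp, hq, smul_add]

/-- The substitution `(x₁, x₂, x₃) ↦ (1 - t, t, (1 + t) / 2)`. -/
noncomputable def substLine (K : Type*) [Field K] : MvPolynomial (Fin 3) K →ₐ[K] Polynomial K :=
  aeval ![1 - .X, .X, .C (1 / 2) * (1 + .X)]

theorem derivative_substLine (v : MvPolynomial (Fin 3) K) :
    Polynomial.derivative (substLine K v) =
      substLine K (-pderiv 0 v + pderiv 1 v + C (1 / 2) * pderiv 2 v) := by
  induction v using MvPolynomial.induction_on with
  | C c => simp [substLine]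
  | add p q hp hq =>
    simp only [map_add, map_mul, map_neg] at hp hq ⊢
    rw [hp, hq]
    ring
  | mul_X p i hp =>
    simp only [map_add, map_mul, map_neg, Derivation.leibniz, Polynomial.derivative_mul, hp,
      pderiv_X, smul_eq_mul] at hp ⊢
    fin_cases i <;> simp [substLine] <;> ring

theorem euler_of_isWeightedHomogeneous_wt {v : MvPolynomial (Fin 3) K} {n : ℤ}
    (hv : IsWeightedHomogeneous wt v n) :
    -(X 0 * pderiv 0 v) + X 2 * pderiv 2 v = (n : MvPolynomial (Fin 3) K) * v := by
  classical
  rw [v.as_sum]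
  simp only [map_sum, Finset.mul_sum]
  rw [← Finset.sum_neg_distrib, ← Finset.sum_add_distrib]
  refine Finset.sum_congr rfl fun s hs => ?_
  have hw := hv (mem_support_iff.mp hs)
  rw [weight_wt] at hw
  rw [X_mul_pderiv_monomial, X_mul_pderiv_monomial, ← hw]
  simp only [nsmul_eq_mul]
  push_cast
  ring

theorem derivative_substLine_X_zero_mul [CharZero K] {v : MvPolynomial (Fin 3) K}
    (hv : IsWeightedHomogeneous wt v 1) :
    Polynomial.derivative (substLine K (X 0 * v)) = substLine K (lowering K v) := by
  have hE := congrArg (substLine K) (euler_of_isWeightedHomogeneous_wt hv)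
  rw [map_mul, Polynomial.derivative_mul, derivative_substLine v, lowering_apply]
  simp only [map_add, map_mul, map_neg, map_sub] at hE ⊢
  have h0 : substLine K (X 0) = 1 - Polynomial.X := by simp [substLine]
  have h1 : substLine K (X 1) = Polynomial.X := by simp [substLine]
  have h2 : substLine K (X 2) = Polynomial.C (1 / 2) * (1 + Polynomial.X) := by simp [substLine]
  have hC : substLine K (C (1 / 2)) = Polynomial.C (1 / 2) := by simp [substLine]
  have hhalf : (Polynomial.C (1 / 2) : Polynomial K) * 2 = 1 := by
    rw [← map_ofNat Polynomial.C 2, ← Polynomial.C_mul, one_div,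
      inv_mul_cancel₀ two_ne_zero, Polynomial.C_1]
  rw [h0, h2] at hE
  rw [h0, h1, hC]
  simp only [Polynomial.derivative_sub, Polynomial.derivative_one, Polynomial.derivative_X,
    Int.cast_one, map_one, one_mul] at hE ⊢
  linear_combination hE - (Polynomial.X * substLine K (pderiv 2 v)) * hhalf

theorem eval_neg_one_substLine {v : MvPolynomial (Fin 3) K}
    (hv : IsWeightedHomogeneous wt v 1) : (substLine K v).eval (-1) = 0 := by
  rw [v.as_sum, map_sum, Polynomial.eval_finsetSum]
  refine Finset.sum_eq_zero fun s hs => ?_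
  have hw := hv (mem_support_iff.mp hs)
  rw [weight_wt] at hw
  have h2 : s 2 ≠ 0 := by omega
  rw [substLine, aeval_monomial, Finsupp.prod_fintype _ _ (by simp), Fin.prod_univ_three]
  simp [h2]

theorem substLine_ne_zero [CharZero K] {h : MvPolynomial (Fin 3) K} {e : ℕ} (h0 : h ≠ 0)
    (he : h.IsHomogeneous e) (hw : IsWeightedHomogeneous wt h 0) : substLine K h ≠ 0 := by
  obtain ⟨b, hb, hmin⟩ := h.support.exists_min_image (fun s => s 1)
    (support_nonempty.mpr h0)
  have hcoord : ∀ s ∈ h.support, s 0 = s 2 ∧ s 0 + s 1 + s 2 = e := by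
    intro s hs
    have h1 := hw (mem_support_iff.mp hs)
    have h2 := he.degree_eq_sum_deg_support hs
    rw [weight_wt] at h1
    refine ⟨by omega, ?_⟩
    rw [h2, ← Finsupp.degree_apply, Finsupp.degree_eq_sum, Fin.sum_univ_three]
  have hmon : ∀ s : Fin 3 →₀ ℕ, ∀ c : K, substLine K (monomial s c) =
      Polynomial.X ^ s 1 * (Polynomial.C c * (1 - Polynomial.X) ^ s 0 *
        (Polynomial.C (1 / 2) * (1 + Polynomial.X)) ^ s 2) := by
    intro s c
    rw [substLine, aeval_monomial, Finsupp.prod_fintype _ _ (by simp), Fin.prod_univ_three,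
      Polynomial.algebraMap_eq]
    simp only [Matrix.cons_val]
    ring
  have hcoeff : (substLine K h).coeff (b 1) = coeff b h * (1 / 2) ^ b 2 := by
    conv_lhs => rw [h.as_sum, map_sum, Polynomial.finsetSum_coeff]
    rw [Finset.sum_eq_single_of_mem b hb]
    · rw [hmon, Polynomial.coeff_X_pow_mul', if_pos le_rfl, Nat.sub_self,
        Polynomial.coeff_zero_eq_eval_zero]
      simp
    · intro s hs hsb
      rw [hmon, Polynomial.coeff_X_pow_mul', if_neg]
      intro hle
      refine hsb (Finsupp.ext fun i => ?_)
      have := hmin s hs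
      have := hcoord s hs
      have := hcoord b hb
      fin_cases i <;> simp <;> omega
  intro hz
  rw [hz, Polynomial.coeff_zero] at hcoeff
  exact mul_ne_zero (mem_support_iff.mp hb) (pow_ne_zero _ (one_div_ne_zero two_ne_zero)) hcoeff.symm

end Substitution

theorem exists_weightedHomogeneousComponent_of_not_degOmega_neg {K : Type*} [Field K]
    {f : MvPolynomial (Fin 3) K} (hf : ¬ degOmega f < 0) :
    ∃ W : ℕ, weightedHomogeneousComponent wt (W : ℤ) f ≠ 0 ∧
      ∀ s ∈ f.support, Finsupp.weight wt s ≤ W := by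
  obtain ⟨b, hb, hb0⟩ : ∃ b ∈ f.support, 0 ≤ Finsupp.weight wt b := by
    by_contra! hneg
    refine hf ((Finset.sup_lt_iff (by exact WithBot.bot_lt_coe 0)).mpr fun b hb => ?_)
    have := hneg b hb
    rw [weight_wt] at this
    exact_mod_cast this
  obtain ⟨W, hW, hmax⟩ := exists_weightedHomogeneousComponent_ne_zero wt
    (support_nonempty.mp ⟨b, hb⟩)
  lift W to ℕ using hb0.trans (hmax b hb)
  exact ⟨W, hW, hmax⟩

theorem homogeneousComponent_sub_mem_range_lowering {K : Type*} [Field K] [CharZero K]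
    {m : ℕ} {a : K} (ham : a ^ m = 1)
    {φ : MvPolynomial (Fin 3) K →ₐ[K] MvPolynomial (Fin 3) K}
    (hφ : ∀ i, φ (X i) = a • expLowering K (X i)) (e : ℕ) (u : MvPolynomial (Fin 3) K) :
    ∃ v, homogeneousComponent (m * e) (u - φ u) = lowering K v := by
  obtain ⟨v, hv⟩ := expLowering_sub_self_mem_range (homogeneousComponent (m * e) u)
  refine ⟨-v, ?_⟩
  rw [map_sub, homogeneousComponent_of_apply_X_eq_smul_expLowering a φ hφ, pow_mul, ham, one_pow,
    one_smul, map_neg, ← hv, neg_sub]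

theorem eq_zero_of_forall_pow_eq_lowering {K : Type*} [Field K] [CharZero K]
    {h : MvPolynomial (Fin 3) K} {e : ℕ} (he : h.IsHomogeneous e)
    (hw : IsWeightedHomogeneous wt h 0)
    (hpow : ∀ j : ℕ, 0 < j → ∃ v, h ^ j = lowering K v) : h = 0 := by
  by_contra h0
  refine substLine_ne_zero h0 he hw (eq_zero_of_forall_pow_eq_derivative _ fun j hj => ?_)
  obtain ⟨v, hv⟩ := hpow j hj
  set v₁ := weightedHomogeneousComponent wt (0 + 1 : ℤ) v
  have hv₁ : IsWeightedHomogeneous wt v₁ 1 := by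
    have := weightedHomogeneousComponent_isWeightedHomogeneous (w := wt) (0 + 1 : ℤ) v
    rwa [zero_add] at this
  have hj₁ : h ^ j = lowering K v₁ := by
    have := hw.pow j
    rw [smul_zero] at this
    rw [← weightedHomogeneousComponent_lowering, ← hv, this.weightedHomogeneousComponent_same]
  refine ⟨substLine K (X 0 * v₁), ?_, ?_⟩
  · rw [derivative_substLine_X_zero_mul hv₁, ← hj₁, map_pow]
  · rw [map_mul, Polynomial.eval_mul, Polynomial.eval_mul, eval_neg_one_substLine hv₁]
    simp [substLine]

theorem degOmega_neg_of_powers_mem_range_delta_a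
    {K : Type*} [Field K] [CharZero K] (m : ℕ) (hm : 0 < m) (a : K)
    (ham : a ^ m = 1) (ha : ∀ j : ℕ, 0 < j → j < m → a ^ j ≠ 1)
    (φ : MvPolynomial (Fin 3) K →ₐ[K] MvPolynomial (Fin 3) K)
    (hφ1 : φ (X 0) = a • X 0)
    (hφ2 : φ (X 1) = a • X 0 + a • X 1)
    (hφ3 : φ (X 2) = -((1 / 2 * a) • X 0) - a • X 1 + a • X 2)
    (δ : MvPolynomial (Fin 3) K →ₗ[K] MvPolynomial (Fin 3) K)
    (hδ : δ = LinearMap.id - φ.toLinearMap)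
    (f : MvPolynomial (Fin 3) K)
    (hf : ∀ i : ℕ, 0 < i → f ^ i ∈ LinearMap.range δ) :
    degOmega f < 0 := by
  by_contra hneg
  obtain ⟨W, hW0, hW⟩ := exists_weightedHomogeneousComponent_of_not_degOmega_neg hneg
  have hφ : ∀ i, φ (X i) = a • expLowering K (X i) := by
    intro i
    fin_cases i
    · simp [expLowering, hφ1]
    · simp [expLowering, hφ2]
    · simp only [expLowering, aeval_X, Fin.reduceFinMk, Matrix.cons_val, hφ3, smul_eq_C_mul, C_mul]
      ring
  set g := weightedHomogeneousComponent wt (W : ℤ) f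
  obtain ⟨d, hd0, hgd⟩ := exists_weightedHomogeneousComponent_ne_zero (1 : Fin 3 → ℕ) hW0
  set q := homogeneousComponent d g
  have hq0 : q ≠ 0 := hd0
  have hqd : q.IsHomogeneous d := homogeneousComponent_isHomogeneous d g
  have hqW : IsWeightedHomogeneous wt q (W : ℤ) := by
    have : weightedHomogeneousComponent wt (W : ℤ) q = q := by
      change weightedHomogeneousComponent wt (W : ℤ) (weightedHomogeneousComponent 1 d g) = q
      rw [weightedHomogeneousComponent_comm,
        (weightedHomogeneousComponent_isWeightedHomogeneous
          (w := wt) _ f).weightedHomogeneousComponent_same]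
      rfl
    rw [← this]
    exact weightedHomogeneousComponent_isWeightedHomogeneous _ _
  have hqpow : ∀ j, 0 < j → ∃ v, q ^ (m * j) = lowering K v := by
    intro j hj
    obtain ⟨u, hu⟩ := hf (m * j) (Nat.mul_pos hm hj)
    obtain ⟨v, hv⟩ := homogeneousComponent_sub_mem_range_lowering ham hφ (j * d) u
    have hfu : f ^ (m * j) = u - φ u := by
      rw [← hu, hδ]
      rfl
    refine ⟨weightedHomogeneousComponent wt ((m * j) • (W : ℤ) + 1) v, ?_⟩
    rw [← weightedHomogeneousComponent_lowering, ← hv, ← hfu, ← mul_assoc]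
    change _ = weightedHomogeneousComponent wt _ (weightedHomogeneousComponent 1 ((m * j) • d) _)
    rw [weightedHomogeneousComponent_comm, (weightedHomogeneousComponent_nsmul_pow wt hW _).1,
      (weightedHomogeneousComponent_nsmul_pow 1 hgd _).1]
    rfl
  refine mul_ne_zero (pow_ne_zero (m * W) (X_ne_zero 0)) (pow_ne_zero m hq0)
    (eq_zero_of_forall_pow_eq_lowering (((isHomogeneous_X K 0).pow (m * W)).mul (hqd.pow m))
      ?_ fun j hj => ?_)
  · have := ((isWeightedHomogeneous_X K wt 0).pow (m * W)).mul (hqW.pow m)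
    rwa [show (m * W) • wt 0 + m • (W : ℤ) = 0 by simp [wt]] at this
  · obtain ⟨v, hv⟩ := hqpow j hj
    refine ⟨X 0 ^ (m * W * j) * v, ?_⟩
    rw [lowering_X_zero_pow_mul, ← hv, mul_pow, ← pow_mul, ← pow_mul]
end

section
/- Let K be a field of characteristic zero, m a positive integer, and a ∈ K a primitive m-th root of unity. Let φ_a be the K-algebra endomorphism of R = K[x1,x2,x3] defined by φ_a(x1) = a·x1, φ_a(x2) = a·x1 + a·x2, φ_a(x3) = −(1/2)·a·x1 − a·x2 + a·x3, and let δ_a = id − φ_a. Then the image of δ_a is a Mathieu-Zhao subspace of R. -/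
open MvPolynomial

universe u

/-- The integral over `[-1, 1]`, as a linear functional on polynomials over a `ℚ`-algebra. -/
noncomputable def symmIntegral (B : Type*) [CommRing B] [Algebra ℚ B] :
    Polynomial B →ₗ[B] B :=
  Polynomial.lsum fun e => LinearMap.lsmul B B (algebraMap ℚ B ((1 + (-1) ^ e) / (e + 1)))

theorem symmIntegral_monomial {B : Type*} [CommRing B] [Algebra ℚ B] (e : ℕ) (c : B) :
    symmIntegral B (Polynomial.monomial e c) = algebraMap ℚ B ((1 + (-1) ^ e) / (e + 1)) * c := by
  simp [symmIntegral, Polynomial.lsum_apply, Polynomial.sum_monomial_index]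

theorem symmIntegral_eq_sum {B : Type*} [CommRing B] [Algebra ℚ B] (P : Polynomial B) :
    symmIntegral B P = ∑ e ∈ Finset.range (P.natDegree + 1),
      algebraMap ℚ B ((1 + (-1) ^ e) / (e + 1)) * P.coeff e := by
  conv_lhs => rw [P.as_sum_range, map_sum]
  simp only [symmIntegral_monomial]

theorem symmIntegral_map {B B' : Type*} [CommRing B] [Algebra ℚ B] [CommRing B'] [Algebra ℚ B']
    (f : B →ₐ[ℚ] B') (P : Polynomial B) :
    symmIntegral B' (P.map (f : B →+* B')) = f (symmIntegral B P) := by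
  induction P using Polynomial.induction_on' with
  | add p q hp hq => simp only [Polynomial.map_add, map_add, hp, hq]
  | monomial e c =>
    rw [Polynomial.map_monomial, symmIntegral_monomial, symmIntegral_monomial, map_mul,
      AlgHom.commutes]
    rfl

theorem symmIntegral_derivative {B : Type*} [CommRing B] [Algebra ℚ B] (P : Polynomial B) :
    symmIntegral B (Polynomial.derivative P) = P.eval 1 - P.eval (-1) := by
  induction P using Polynomial.induction_on' with
  | add p q hp hq => simp only [map_add, hp, hq, Polynomial.eval_add]; ring
  | monomial e c =>
    rw [Polynomial.derivative_monomial, symmIntegral_monomial]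
    rcases e with _ | e
    · simp
    · have h : algebraMap ℚ B ((1 + (-1) ^ e) / (e + 1)) * ((e + 1 : ℕ) : B) =
          1 - (-1) ^ (e + 1) := by
        rw [← map_natCast (algebraMap ℚ B), ← map_mul, Nat.cast_succ,
          div_mul_cancel₀ _ (Nat.cast_add_one_ne_zero e)]
        simp [pow_succ]
      simp only [Nat.add_sub_cancel, Polynomial.eval_monomial, one_pow]
      linear_combination c * h

theorem exists_natCast_pow_mul_isIntegral {L : Type*} [Field L] [CharZero L]
    [Algebra.IsAlgebraic ℚ L] (s : Finset L) :
    ∃ M : ℕ, M ≠ 0 ∧ ∀ x ∈ Algebra.adjoin ℤ (s : Set L), ∃ A : ℕ,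
      IsIntegral ℤ ((M : L) ^ A * x) := by
  have : Algebra.IsAlgebraic ℤ L := (IsFractionRing.comap_isAlgebraic_iff (K := ℚ)).mpr ‹_›
  obtain ⟨y, hy, h⟩ := Algebra.IsAlgebraic.exists_integral_multiples ℤ s
  have hn : IsIntegral ℤ (y.natAbs : L) := by
    simpa using isIntegral_algebraMap (R := ℤ) (A := L) (x := y.natAbs)
  refine ⟨y.natAbs, Int.natAbs_ne_zero.mpr hy, fun x hx => ?_⟩
  induction hx using Algebra.adjoin_induction with
  | mem x hx =>
    refine ⟨1, ?_⟩
    have := h x hx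
    rw [zsmul_eq_mul] at this
    rcases Int.natAbs_eq y with h' | h'
    · rw [h'] at this
      simpa using this
    · rw [h'] at this
      simpa using this
  | algebraMap r => exact ⟨0, by simpa using isIntegral_algebraMap (R := ℤ) (A := L) (x := r)⟩
  | add x z _ _ hx hz =>
    obtain ⟨A, hA⟩ := hx
    obtain ⟨B, hB⟩ := hz
    refine ⟨A + B, ?_⟩
    rw [show (y.natAbs : L) ^ (A + B) * (x + z) = (y.natAbs : L) ^ B * ((y.natAbs : L) ^ A * x) +
      (y.natAbs : L) ^ A * ((y.natAbs : L) ^ B * z) by ring]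
    exact ((hn.pow B).mul hA).add ((hn.pow A).mul hB)
  | mul x z _ _ hx hz =>
    obtain ⟨A, hA⟩ := hx
    obtain ⟨B, hB⟩ := hz
    refine ⟨A + B, ?_⟩
    rw [pow_add, mul_mul_mul_comm]
    exact hA.mul hB

theorem coeff_pow_mem {R L : Type*} [CommRing R] [CommRing L] [Algebra R L] {Q : Polynomial L}
    {B : Subalgebra R L} (h : ∀ n, Q.coeff n ∈ B) (k n : ℕ) : (Q ^ k).coeff n ∈ B := by
  have hQ : Q ∈ Polynomial.lifts (B.val : B →+* L) :=
    (Polynomial.lifts_iff_coeff_lifts Q).mpr fun n => ⟨⟨_, h n⟩, rfl⟩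
  obtain ⟨x, hx⟩ := (Polynomial.lifts_iff_coeff_lifts _).mp (pow_mem hQ k) n
  rw [← hx]
  exact x.2

theorem exists_symmIntegral_pow_ne_zero_of_isAlgebraic {L : Type*} [Field L] [CharZero L]
    [Algebra.IsAlgebraic ℚ L] {Q : Polynomial L} (hQ : Q ≠ 0) (hev : Even Q.natDegree) :
    ∃ k : ℕ, 0 < k ∧ symmIntegral L (Q ^ k) ≠ 0 := by
  classical
  by_contra! H
  rcases Nat.eq_zero_or_pos Q.natDegree with h0 | hpos
  · have := H 1 one_pos
    rw [pow_one, Polynomial.eq_C_of_natDegree_eq_zero h0, ← Polynomial.monomial_zero_left,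
      symmIntegral_monomial] at this
    have h2 : Q.coeff 0 = 0 := by simpa using this
    exact hQ (by rw [Polynomial.eq_C_of_natDegree_eq_zero h0, h2, map_zero])
  set c := Q.leadingCoeff with hc
  have hc0 : c ≠ 0 := Polynomial.leadingCoeff_ne_zero.mpr hQ
  obtain ⟨M, hM, hMint⟩ := exists_natCast_pow_mul_isIntegral (insert c⁻¹ (Q.support.image Q.coeff))
  set B := Algebra.adjoin ℤ (↑(insert c⁻¹ (Q.support.image Q.coeff)) : Set L)
  have hcoeff (n : ℕ) : Q.coeff n ∈ B := by
    by_cases hn : Q.coeff n = 0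
    · rw [hn]
      exact B.zero_mem
    · exact Algebra.subset_adjoin (by simpa using Or.inr ⟨n, hn, rfl⟩)
  have hcinv : c⁻¹ ∈ B := Algebra.subset_adjoin (by simp)
  obtain ⟨p, hp, hpM, hmod⟩ := Nat.exists_prime_gt_modEq_one (M + 2) hpos.ne'
  obtain ⟨k, hk⟩ : ∃ k, p = Q.natDegree * k + 1 := by
    obtain ⟨k, hk⟩ := (Nat.modEq_iff_dvd' hp.one_le).mp hmod.symm
    exact ⟨k, by omega⟩
  have hkpos : 0 < k := by
    rcases Nat.eq_zero_or_pos k with rfl | h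
    · omega
    · exact h
  have hdeg : (Q ^ k).natDegree = p - 1 := by
    rw [Polynomial.natDegree_pow, hk, mul_comm]
    rfl
  have hI := H k hkpos
  have hp1 : p - 1 + 1 = p := by omega
  have hpev : Even (p - 1) := by rw [hk]; exact hev.mul_right k
  rw [symmIntegral_eq_sum, hdeg, Finset.sum_range_succ, ← hdeg, Polynomial.coeff_natDegree,
    Polynomial.leadingCoeff_pow, hdeg, hpev.neg_one_pow] at hI
  have hlow : ((p - 1).factorial : L) * ∑ e ∈ Finset.range (p - 1),
      algebraMap ℚ L ((1 + (-1) ^ e) / (e + 1)) * (Q ^ k).coeff e ∈ B := by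
    rw [Finset.mul_sum]
    refine B.sum_mem fun e he => ?_
    obtain ⟨z, hz⟩ : e + 1 ∣ (p - 1).factorial :=
      Nat.dvd_factorial e.succ_pos (Finset.mem_range.mp he)
    rw [← mul_assoc]
    refine B.mul_mem ?_ (coeff_pow_mem hcoeff k e)
    have : ((p - 1).factorial : L) * algebraMap ℚ L ((1 + (-1) ^ e) / (e + 1)) =
        algebraMap ℤ L (z * (1 + (-1) ^ e)) := by
      have he1 : (e + 1 : L) ≠ 0 := Nat.cast_add_one_ne_zero e
      rw [hz]
      simp
      field_simp
    rw [this]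
    exact B.algebraMap_mem _
  have htop : (((p - 1).factorial * 2 / p : ℚ) : L) ∈ B := by
    have hpcast : ((p - 1 : ℕ) : ℚ) + 1 = p := by exact_mod_cast hp1
    have := B.mul_mem (B.neg_mem hlow) (B.pow_mem hcinv k)
    convert this using 1
    rw [eq_neg_of_add_eq_zero_left hI, hpcast, ← hc, inv_pow]
    have := pow_ne_zero k hc0
    simp
    field_simp
    norm_num
  obtain ⟨A, hA⟩ := hMint _ htop
  have hA' : IsIntegral ℤ ((M : ℚ) ^ A * ((p - 1).factorial * 2 / p)) := by
    rw [← isIntegral_algebraMap_iff (algebraMap ℚ L).injective]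
    simpa using hA
  obtain ⟨z, hz⟩ := IsIntegrallyClosed.isIntegral_iff.mp hA'
  have hp0 : (p : ℚ) ≠ 0 := by exact_mod_cast hp.ne_zero
  have hdvd : (p : ℤ) ∣ ((M ^ A * ((p - 1).factorial * 2) : ℕ) : ℤ) := by
    refine ⟨z, ?_⟩
    have : (M : ℚ) ^ A * ((p - 1).factorial * 2) = p * z := by
      rw [eq_intCast] at hz
      rw [hz]
      field_simp
    exact_mod_cast this
  rw [Int.natCast_dvd_natCast, hp.dvd_mul, hp.dvd_mul, hp.dvd_factorial] at hdvd
  rcases hdvd with h | h | h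
  · exact absurd (Nat.le_of_dvd (Nat.pos_of_ne_zero hM) (hp.dvd_of_dvd_pow h)) (by omega)
  · omega
  · exact absurd (Nat.le_of_dvd two_pos h) (by omega)

theorem exists_algHom_isAlgebraic_of_finiteType {B : Type u} [CommRing B] [Nontrivial B]
    [Algebra ℚ B] [Algebra.FiniteType ℚ B] :
    ∃ (L : Type u) (_ : Field L) (_ : CharZero L) (_ : Algebra.IsAlgebraic ℚ L),
      Nonempty (B →ₐ[ℚ] L) := by
  obtain ⟨I, hI⟩ := Ideal.exists_maximal B
  let : Field (B ⧸ I) := Ideal.Quotient.field I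
  have : CharZero (B ⧸ I) := charZero_of_injective_algebraMap (algebraMap ℚ (B ⧸ I)).injective
  let f : B →ₐ[ℚ] B ⧸ I := (Ideal.Quotient.mk I).toRatAlgHom
  have : Algebra.FiniteType ℚ (B ⧸ I) :=
    Algebra.FiniteType.of_surjective f Ideal.Quotient.mk_surjective
  have := finite_of_finite_type_of_isJacobsonRing ℚ (B ⧸ I)
  exact ⟨B ⧸ I, inferInstance, inferInstance, Algebra.IsAlgebraic.of_finite ℚ _, ⟨f⟩⟩

theorem exists_symmIntegral_pow_ne_zero {K : Type*} [Field K] [CharZero K] {Q : Polynomial K}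
    (hQ : Q ≠ 0) : ∃ k : ℕ, 0 < k ∧ symmIntegral K (Q ^ k) ≠ 0 := by
  classical
  have hc0 : Q.leadingCoeff ≠ 0 := Polynomial.leadingCoeff_ne_zero.mpr hQ
  set s : Finset K := insert Q.leadingCoeff⁻¹ (Q.support.image Q.coeff)
  let B := Algebra.adjoin ℚ (s : Set K)
  have hcoeff (n : ℕ) : Q.coeff n ∈ B := by
    by_cases hn : Q.coeff n = 0
    · rw [hn]
      exact B.zero_mem
    · exact Algebra.subset_adjoin (by simpa [s] using Or.inr ⟨n, hn, rfl⟩)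
  have hcinv : Q.leadingCoeff⁻¹ ∈ B := Algebra.subset_adjoin (by simp [s])
  have : Algebra.FiniteType ℚ B := B.fg_iff_finiteType.mp ⟨s, rfl⟩
  obtain ⟨L, _, _, _, ⟨f⟩⟩ := exists_algHom_isAlgebraic_of_finiteType (B := B)
  obtain ⟨P, hP⟩ : ∃ P : Polynomial B, P.map (B.val : B →+* K) = Q :=
    (Polynomial.mem_lifts Q).mp
      ((Polynomial.lifts_iff_coeff_lifts Q).mpr fun n => ⟨⟨_, hcoeff n⟩, rfl⟩)
  have hPne : P.map (f : B →+* L) ≠ 0 := by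
    intro h
    have h1 : P.coeff Q.natDegree * ⟨_, hcinv⟩ = 1 := by
      apply Subtype.ext
      have h2 : (P.coeff Q.natDegree : K) = Q.leadingCoeff := by
        rw [Polynomial.leadingCoeff, ← hP, Polynomial.coeff_map, hP]
        rfl
      simp [h2, hc0]
    have h2 := congrArg f h1
    have h3 : f (P.coeff Q.natDegree) = 0 := by
      simpa using congrArg (fun R => R.coeff Q.natDegree) h
    simp [h3] at h2
  obtain ⟨k, hk, hne⟩ := exists_symmIntegral_pow_ne_zero_of_isAlgebraic (pow_ne_zero 2 hPne)
    (by rw [Polynomial.natDegree_pow]; exact even_two_mul _)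
  refine ⟨2 * k, by omega, fun h => hne ?_⟩
  rw [← hP, ← Polynomial.map_pow, symmIntegral_map] at h
  have h0 : symmIntegral B (P ^ (2 * k)) = 0 := Subtype.ext h
  rw [← pow_mul, ← Polynomial.map_pow, symmIntegral_map, h0, map_zero]

theorem X_zero_pow_succ_mul_mem_range {K : Type*} [Field K] [CharZero K] {a : K}
    {φ : MvPolynomial (Fin 3) K →ₐ[K] MvPolynomial (Fin 3) K} {q : MvPolynomial (Fin 3) K}
    (h0 : φ (X 0) = a • X 0) (h1 : φ (X 1) = a • X 0 + a • X 1) (hq : φ q = a ^ 2 • q)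
    (b k c : ℕ) :
    X 0 ^ (k + 1) * X 1 ^ b * q ^ c ∈ LinearMap.range (LinearMap.id - φ.toLinearMap) := by
  have hφ (k b c : ℕ) : φ (X 0 ^ k * X 1 ^ b * q ^ c) =
      a ^ (k + b + 2 * c) • (X 0 ^ k * (X 1 + X 0) ^ b * q ^ c) := by
    simp only [map_mul, map_pow, h0, h1, hq, ← smul_add, smul_pow, smul_mul_smul_comm,
      add_comm (X 0 : MvPolynomial (Fin 3) K) (X 1), ← pow_mul, pow_add]
  have hδ (g) : g - φ g ∈ LinearMap.range (LinearMap.id - φ.toLinearMap) := ⟨g, rfl⟩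
  induction b using Nat.strong_induction_on generalizing k c with
  | _ b ih =>
  set M := LinearMap.range (LinearMap.id - φ.toLinearMap) with hM
  have low (N k' : ℕ) (hN : b < N + k') :
      ∑ j ∈ Finset.range b, ((X 1 : MvPolynomial (Fin 3) K) ^ j * X 0 ^ (N - j) *
        (N.choose j : MvPolynomial (Fin 3) K)) * (X 0 ^ k' * q ^ c) ∈ M := by
    refine M.sum_mem fun j hj => ?_
    rw [Finset.mem_range] at hj
    by_cases hjN : j ≤ N
    · have := M.smul_mem (N.choose j : K) (ih j hj (N - j + k' - 1) c)
      convert this using 1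
      rw [show N - j + k' - 1 + 1 = (N - j) + k' by omega, MvPolynomial.smul_eq_C_mul, map_natCast]
      ring
    · simp [Nat.choose_eq_zero_of_lt (not_le.mp hjN)]
  by_cases had : a ^ (k + 1 + b + 2 * c) = 1
  · have h := hδ (X 0 ^ k * X 1 ^ (b + 1) * q ^ c)
    rw [hφ, show k + (b + 1) + 2 * c = k + 1 + b + 2 * c by ring, had, one_smul, add_pow,
      Finset.sum_range_succ, Finset.sum_range_succ] at h
    have h2 := M.smul_mem (-(b + 1 : K)⁻¹) (M.add_mem h (low (b + 1) k (by omega)))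
    convert h2 using 1
    rw [← Finset.sum_mul, eq_comm, neg_smul, neg_eq_iff_eq_neg,
      inv_smul_eq_iff₀ (Nat.cast_add_one_ne_zero b),
      MvPolynomial.smul_eq_C_mul]
    simp
    ring
  · have h := hδ (X 0 ^ (k + 1) * X 1 ^ b * q ^ c)
    rw [hφ, add_pow, Finset.sum_range_succ] at h
    have h2 := M.smul_mem ((1 - a ^ (k + 1 + b + 2 * c))⁻¹)
      (M.add_mem h (M.smul_mem (a ^ (k + 1 + b + 2 * c)) (low b (k + 1) (by omega))))
    convert h2 using 1
    rw [← Finset.sum_mul, eq_comm, inv_smul_eq_iff₀ (sub_ne_zero.mpr (Ne.symm had))]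
    simp only [MvPolynomial.smul_eq_C_mul]
    simp
    ring

theorem monomial_mem_range_of_lt {K : Type*} [Field K] [CharZero K] {a : K}
    {φ : MvPolynomial (Fin 3) K →ₐ[K] MvPolynomial (Fin 3) K}
    (h0 : φ (X 0) = a • X 0) (h1 : φ (X 1) = a • X 0 + a • X 1)
    (h2 : φ (X 2) = -((1 / 2 * a) • X 0) - a • X 1 + a • X 2)
    {s : Fin 3 →₀ ℕ} (hs : s 2 < s 0) (r : K) :
    monomial s r ∈ LinearMap.range (LinearMap.id - φ.toLinearMap) := by
  set q : MvPolynomial (Fin 3) K := X 1 ^ 2 + 2 * (X 0 * X 2) with hqdef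
  have half : (C (1 / 2 : K) : MvPolynomial (Fin 3) K) * 2 = 1 := by
    rw [show (2 : MvPolynomial (Fin 3) K) = C 2 from rfl, ← C_mul]
    simp
  have hq : φ q = a ^ 2 • q := by
    simp only [hqdef, map_add, map_mul, map_pow, map_ofNat, h0, h1, h2,
      MvPolynomial.smul_eq_C_mul]
    linear_combination (-C a ^ 2 * X 0 ^ 2) * half
  set M := LinearMap.range (LinearMap.id - φ.toLinearMap) with hM
  have key (g k b c : ℕ) :
      X 0 ^ (k + 1) * X 1 ^ b * (X 0 * X 2) ^ g * q ^ c ∈ M := by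
    induction g generalizing b c with
    | zero =>
      rw [pow_zero, mul_one]
      exact X_zero_pow_succ_mul_mem_range h0 h1 hq b k c
    | succ g ih =>
      convert M.smul_mem (1 / 2 : K) (M.sub_mem (ih b (c + 1)) (ih (b + 2) c)) using 1
      rw [MvPolynomial.smul_eq_C_mul]
      linear_combination (-(X 0 ^ (k + 1) * X 1 ^ b * (X 0 * X 2) ^ (g + 1) * q ^ c)) * half
  obtain ⟨k, hk⟩ := Nat.exists_eq_add_of_lt hs
  convert M.smul_mem r (key (s 2) k (s 1) 0) using 1
  rw [monomial_eq, Finsupp.prod_fintype _ _ (by simp), Fin.prod_univ_three, hk,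
    MvPolynomial.smul_eq_C_mul]
  ring

/-- The polynomial `(1 - v ^ 2) / 2`: on the curve `x₀ = 1`, `x₁ = v`, `x₂ = (1 - v ^ 2) / 2` the
invariant `x₁ ^ 2 + 2 x₀ x₂` equals `1`. -/
noncomputable def conic (K : Type*) [Field K] : Polynomial K :=
  Polynomial.C (1 / 2) * (1 - Polynomial.X ^ 2)

theorem coeff_taylor_X_pow_mul_conic_pow {K : Type*} [Field K] [CharZero K] {r : K}
    (hr : r ^ 2 = 1) {b c k : ℕ} (hk : k < c) :
    (Polynomial.taylor r (Polynomial.X ^ b * conic K ^ c)).coeff k = 0 := by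
  refine Polynomial.X_pow_dvd_iff.mp ?_ k hk
  rw [Polynomial.taylor_mul, Polynomial.taylor_pow, Polynomial.taylor_pow]
  refine Dvd.dvd.mul_left (pow_dvd_pow_of_dvd ?_ c) _
  rw [Polynomial.X_dvd_iff, Polynomial.taylor_coeff_zero]
  simp [conic, hr]

theorem symmIntegral_hasseDeriv_eq_zero {K : Type*} [Field K] [CharZero K] {b c k : ℕ}
    (hk : 0 < k) (hkc : k ≤ c) :
    symmIntegral K (Polynomial.hasseDeriv k (Polynomial.X ^ b * conic K ^ c)) = 0 := by
  obtain ⟨k, rfl⟩ := Nat.exists_eq_add_one.mpr hk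
  have h := LinearMap.congr_fun (Polynomial.hasseDeriv_comp (R := K) 1 k)
    (Polynomial.X ^ b * conic K ^ c)
  rw [Polynomial.hasseDeriv_one, add_comm 1 k, Nat.choose_one_right, LinearMap.comp_apply,
    LinearMap.smul_apply] at h
  have h2 := congrArg (symmIntegral K) h
  rw [symmIntegral_derivative, ← Polynomial.taylor_coeff, ← Polynomial.taylor_coeff,
    coeff_taylor_X_pow_mul_conic_pow (by simp) hkc, coeff_taylor_X_pow_mul_conic_pow (by simp) hkc,
    map_nsmul, sub_zero, eq_comm, nsmul_eq_mul] at h2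
  exact (mul_eq_zero.mp h2).resolve_left (by exact_mod_cast k.succ_ne_zero)

theorem coeff_taylor_map_C {R : Type*} [CommRing R] (G : Polynomial R) (k : ℕ) :
    (Polynomial.taylor (Polynomial.X : Polynomial R) (G.map Polynomial.C)).coeff k =
      Polynomial.hasseDeriv k G := by
  induction G using Polynomial.induction_on' with
  | add p q hp hq => simp only [Polynomial.map_add, map_add, Polynomial.coeff_add, hp, hq]
  | monomial n c =>
    rw [Polynomial.taylor_coeff, Polynomial.map_monomial, Polynomial.hasseDeriv_monomial,
      Polynomial.hasseDeriv_monomial, Polynomial.eval_monomial,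
      ← Polynomial.C_mul_X_pow_eq_monomial]
    simp

/-- Substitution of the parametrization `(t s, t v, t s⁻¹ (1 - v ^ 2) / 2)`, with values in series
in `s` and `t` over `K[v]`. The exponent of `s` is `deg x₀ - deg x₂`, that of `t` is the degree. -/
noncomputable def paramHom (K : Type*) [Field K] :
    MvPolynomial (Fin 3) K →ₐ[K] HahnSeries (ℤ ×ₗ ℤ) (Polynomial K) :=
  aeval ![HahnSeries.single (toLex (1, 1)) 1, HahnSeries.single (toLex (0, 1)) Polynomial.X,
    HahnSeries.single (toLex (-1, 1)) (conic K)]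

/-- The pair (exponent of `x₀` minus exponent of `x₂`, total degree). -/
def biDegree (s : Fin 3 →₀ ℕ) : ℤ ×ₗ ℤ :=
  toLex ((s 0 : ℤ) - s 2, (s 0 : ℤ) + s 1 + s 2)

theorem nsmul_toLex (n : ℕ) (i d : ℤ) :
    n • (toLex (i, d) : ℤ ×ₗ ℤ) = toLex ((n : ℤ) * i, (n : ℤ) * d) := by
  rw [← nsmul_eq_mul, ← nsmul_eq_mul]
  rfl

theorem single_toLex_pow {R : Type*} [CommRing R] (i d : ℤ) (r : R) (n : ℕ) :
    HahnSeries.single (toLex (i, d)) r ^ n =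
      HahnSeries.single (toLex ((n : ℤ) * i, (n : ℤ) * d)) (r ^ n) := by
  rw [HahnSeries.single_pow, nsmul_toLex]

theorem single_toLex_mul {R : Type*} [CommRing R] (i d i' d' : ℤ) (r r' : R) :
    HahnSeries.single (toLex (i, d)) r * HahnSeries.single (toLex (i', d')) r' =
      HahnSeries.single (toLex (i + i', d + d')) (r * r') :=
  HahnSeries.single_mul_single

theorem paramHom_C {K : Type*} [Field K] (r : K) :
    paramHom K (C r) = HahnSeries.single (toLex ((0 : ℤ), (0 : ℤ))) (Polynomial.C r) :=
  (paramHom K).commutes r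

theorem paramHom_X_zero (K : Type*) [Field K] :
    paramHom K (X 0) = HahnSeries.single (toLex (1, 1)) 1 := by
  simp [paramHom]

theorem paramHom_X_one (K : Type*) [Field K] :
    paramHom K (X 1) = HahnSeries.single (toLex (0, 1)) Polynomial.X := by
  simp [paramHom]

theorem paramHom_X_two (K : Type*) [Field K] :
    paramHom K (X 2) = HahnSeries.single (toLex (-1, 1)) (conic K) := by
  simp [paramHom]

theorem paramHom_monomial {K : Type*} [Field K] (s : Fin 3 →₀ ℕ) (r : K) :
    paramHom K (monomial s r) = HahnSeries.single (biDegree s)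
      (Polynomial.C r * (Polynomial.X ^ s 1 * conic K ^ s 2)) := by
  rw [monomial_eq, Finsupp.prod_fintype _ _ (by simp), Fin.prod_univ_three]
  simp only [map_mul, map_pow, paramHom_C, paramHom_X_zero, paramHom_X_one, paramHom_X_two,
    single_toLex_pow, single_toLex_mul, biDegree, one_pow, one_mul]
  ring_nf

theorem coeff_paramHom {K : Type*} [Field K] (f : MvPolynomial (Fin 3) K) (g : ℤ ×ₗ ℤ) :
    (paramHom K f).coeff g = ∑ s ∈ f.support with biDegree s = g,
      Polynomial.C (f.coeff s) * (Polynomial.X ^ s 1 * conic K ^ s 2) := by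
  conv_lhs => rw [f.as_sum, map_sum]
  rw [HahnSeries.coeff_sum, Finset.sum_filter]
  refine Finset.sum_congr rfl fun s _ => ?_
  rw [paramHom_monomial, HahnSeries.coeff_single]
  simp only [eq_comm]
  congr

theorem exists_coeff_paramHom_ne_zero {K : Type*} [Field K] [CharZero K]
    {f : MvPolynomial (Fin 3) K} {s : Fin 3 →₀ ℕ} (hs : s ∈ f.support) :
    (paramHom K f).coeff (biDegree s) ≠ 0 := by
  obtain ⟨u, hu, hmin⟩ := (f.support.filter (biDegree · = biDegree s)).exists_min_image (· 1)
    ⟨s, by simpa using hs⟩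
  intro h
  rw [coeff_paramHom] at h
  have h1 := congrArg (fun P => P.coeff (u 1)) h
  simp only [Polynomial.finsetSum_coeff, Polynomial.coeff_C_mul, Polynomial.coeff_zero] at h1
  rw [Finset.sum_eq_single_of_mem u hu] at h1
  · rw [Polynomial.coeff_X_pow_mul', if_pos le_rfl, Nat.sub_self,
      Polynomial.coeff_zero_eq_eval_zero] at h1
    have h2 : f.coeff u ≠ 0 := by
      simpa using (Finset.mem_filter.mp hu).1
    simp [conic, h2] at h1
  · intro w hw hwu
    rw [Polynomial.coeff_X_pow_mul', if_neg, mul_zero]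
    intro hle
    apply hwu
    have hwt : biDegree w = biDegree u :=
      (Finset.mem_filter.mp hw).2.trans (Finset.mem_filter.mp hu).2.symm
    simp only [biDegree, EmbeddingLike.apply_eq_iff_eq, Prod.mk.injEq] at hwt
    have := hmin w hw
    ext j
    fin_cases j <;> simp <;> omega

theorem coeff_aeval_single {R : Type*} [CommRing R] (P : Polynomial R) (k e : ℤ) :
    (Polynomial.aeval (HahnSeries.single (toLex ((1 : ℤ), (0 : ℤ))) (1 : R)) P).coeff
      (toLex (k, e)) = if e = 0 ∧ 0 ≤ k then P.coeff k.toNat else 0 := by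
  induction P using Polynomial.induction_on' with
  | add p q hp hq =>
    rw [map_add, HahnSeries.coeff_add, hp, hq]
    split_ifs <;> simp
  | monomial n c =>
    rw [Polynomial.aeval_monomial, single_toLex_pow, HahnSeries.algebraMap_apply,
      HahnSeries.C_apply, HahnSeries.coeff_single_zero_mul, HahnSeries.coeff_single,
      Polynomial.coeff_monomial]
    simp only [EmbeddingLike.apply_eq_iff_eq, Prod.mk.injEq, mul_one, mul_zero, one_pow,
      Algebra.algebraMap_self, RingHom.id_apply]
    split_ifs <;> first | omega | simp

theorem paramHom_map_monomial {K : Type*} [Field K] [CharZero K] {a : K}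
    {φ : MvPolynomial (Fin 3) K →ₐ[K] MvPolynomial (Fin 3) K}
    (h0 : φ (X 0) = a • X 0) (h1 : φ (X 1) = a • X 0 + a • X 1)
    (h2 : φ (X 2) = -((1 / 2 * a) • X 0) - a • X 1 + a • X 2) (s : Fin 3 →₀ ℕ) (r : K) :
    paramHom K (φ (monomial s r)) =
      HahnSeries.single (biDegree s) (Polynomial.C (r * a ^ (s 0 + s 1 + s 2))) *
        Polynomial.aeval (HahnSeries.single (toLex ((1 : ℤ), (0 : ℤ))) (1 : Polynomial K))
          (Polynomial.taylor Polynomial.X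
            ((Polynomial.X ^ s 1 * conic K ^ s 2).map Polynomial.C)) := by
  have hC (P : Polynomial K) : HahnSeries.C P = HahnSeries.single (toLex ((0 : ℤ), (0 : ℤ))) P :=
    rfl
  set θ := Polynomial.aeval (R := Polynomial K)
    (HahnSeries.single (toLex ((1 : ℤ), (0 : ℤ))) (1 : Polynomial K)) with hθ
  have t0 : paramHom K (φ (X 0)) = HahnSeries.single (toLex (1, 1)) (Polynomial.C a) := by
    rw [h0, smul_eq_C_mul, map_mul, paramHom_C, paramHom_X_zero, single_toLex_mul]
    simp
  have t1 : paramHom K (φ (X 1)) = HahnSeries.single (toLex (0, 1)) (Polynomial.C a) *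
      θ (Polynomial.taylor Polynomial.X (Polynomial.X.map Polynomial.C)) := by
    rw [Polynomial.map_X, Polynomial.taylor_X, map_add, hθ, Polynomial.aeval_X, Polynomial.aeval_C,
      h1]
    simp only [smul_eq_C_mul, map_add, map_mul, paramHom_C, paramHom_X_zero, paramHom_X_one,
      HahnSeries.algebraMap_apply, hC, single_toLex_mul, mul_add]
    simp
  have t2 : paramHom K (φ (X 2)) = HahnSeries.single (toLex (-1, 1)) (Polynomial.C a) *
      θ (Polynomial.taylor Polynomial.X ((conic K).map Polynomial.C)) := by
    have hconic : Polynomial.taylor Polynomial.X ((conic K).map Polynomial.C) =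
        Polynomial.C (conic K) - Polynomial.C Polynomial.X * Polynomial.X -
          Polynomial.C (Polynomial.C (1 / 2)) * Polynomial.X ^ 2 := by
      have h : (Polynomial.C (Polynomial.C (1 / 2 : K))) * 2 = 1 := by
        rw [show (2 : Polynomial (Polynomial K)) = Polynomial.C (Polynomial.C 2) from rfl,
          ← Polynomial.C_mul, ← Polynomial.C_mul]
        simp
      simp only [conic, Polynomial.map_mul, Polynomial.map_sub, Polynomial.map_one,
        Polynomial.map_pow, Polynomial.map_X, Polynomial.map_C, Polynomial.taylor_mul, map_sub,
        Polynomial.taylor_pow, Polynomial.taylor_X, Polynomial.taylor_C, Polynomial.taylor_one,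
        map_mul, map_pow, map_one]
      linear_combination (-Polynomial.X * Polynomial.C Polynomial.X) * h
    rw [hconic, map_sub, map_sub, map_mul, map_mul, map_pow, hθ, Polynomial.aeval_X,
      Polynomial.aeval_C, Polynomial.aeval_C, Polynomial.aeval_C, h2]
    simp only [smul_eq_C_mul, map_add, map_sub, map_neg, map_mul, paramHom_C, paramHom_X_zero,
      paramHom_X_one, paramHom_X_two, HahnSeries.algebraMap_apply, Algebra.algebraMap_self,
      RingHom.id_apply, hC, single_toLex_mul, mul_sub, single_toLex_pow]
    ring_nf
  have tC : paramHom K (φ (C r)) =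
      HahnSeries.single (toLex ((0 : ℤ), (0 : ℤ))) (Polynomial.C r) := by
    rw [show φ (C r) = C r from φ.commutes r, paramHom_C]
  rw [monomial_eq, Finsupp.prod_fintype _ _ (by simp), Fin.prod_univ_three, Polynomial.map_mul,
    Polynomial.map_pow, Polynomial.map_pow, Polynomial.taylor_mul, Polynomial.taylor_pow,
    Polynomial.taylor_pow, map_mul θ, map_pow θ, map_pow θ]
  simp only [map_mul, map_pow, tC, t0, t1, t2, mul_pow, single_toLex_pow]
  have hs : HahnSeries.single (biDegree s) (Polynomial.C r * Polynomial.C a ^ (s 0 + s 1 + s 2)) =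
      HahnSeries.single (toLex ((0 : ℤ), (0 : ℤ))) (Polynomial.C r) *
        (HahnSeries.single (toLex ((s 0 : ℤ) * 1, (s 0 : ℤ) * 1)) (Polynomial.C a ^ s 0) *
        HahnSeries.single (toLex ((s 1 : ℤ) * 0, (s 1 : ℤ) * 1)) (Polynomial.C a ^ s 1) *
        HahnSeries.single (toLex ((s 2 : ℤ) * (-1), (s 2 : ℤ) * 1)) (Polynomial.C a ^ s 2)) := by
    simp only [single_toLex_mul, biDegree]
    ring_nf
  rw [hs]
  ring

theorem symmIntegral_coeff_paramHom_map {K : Type*} [Field K] [CharZero K] {m : ℕ} {a : K}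
    (ham : a ^ m = 1) {φ : MvPolynomial (Fin 3) K →ₐ[K] MvPolynomial (Fin 3) K}
    (h0 : φ (X 0) = a • X 0) (h1 : φ (X 1) = a • X 0 + a • X 1)
    (h2 : φ (X 2) = -((1 / 2 * a) • X 0) - a • X 1 + a • X 2) {i d : ℤ} (hi : i ≤ 0)
    (hd : (m : ℤ) ∣ d) (f : MvPolynomial (Fin 3) K) :
    symmIntegral K ((paramHom K (φ f)).coeff (toLex (i, d))) =
      symmIntegral K ((paramHom K f).coeff (toLex (i, d))) := by
  induction f using MvPolynomial.induction_on' with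
  | add p q hp hq => simp only [map_add, HahnSeries.coeff_add, hp, hq]
  | monomial s r =>
    rw [paramHom_map_monomial h0 h1 h2, paramHom_monomial, HahnSeries.coeff_single_mul,
      HahnSeries.coeff_single, biDegree, ← toLex_sub, Prod.mk_sub_mk, coeff_aeval_single,
      coeff_taylor_map_C]
    by_cases hds : d = (s 0 : ℤ) + s 1 + s 2
    · obtain ⟨n, hn⟩ : m ∣ s 0 + s 1 + s 2 := by
        rw [hds] at hd
        exact_mod_cast hd
      rw [hn, pow_mul, ham, one_pow, mul_one]
      rcases lt_trichotomy i ((s 0 : ℤ) - s 2) with h | h | h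
      · rw [if_neg (by omega), if_neg (by simp; omega), mul_zero]
      · subst h
        simp [hds]
      · rw [if_pos (by omega), if_neg (by simp; omega), ← Polynomial.smul_eq_C_mul, map_smul,
          symmIntegral_hasseDeriv_eq_zero (by omega) (by omega), smul_zero, map_zero]
    · rw [if_neg (by omega), if_neg (by simp; omega), mul_zero]

theorem leadingCoeff_pow_eq_coeff {Γ R : Type*} [AddCommMonoid Γ] [LinearOrder Γ]
    [IsOrderedCancelAddMonoid Γ] [CommRing R] [IsDomain R] (F : HahnSeries Γ R) (n : ℕ) :
    F.leadingCoeff ^ n = (F ^ n).coeff (n • F.order) := by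
  rw [← HahnSeries.order_pow, ← HahnSeries.leadingCoeff_eq]
  induction n with
  | zero => simp
  | succ n ih => rw [pow_succ, pow_succ, HahnSeries.leadingCoeff_mul, ih]

theorem lt_of_forall_pow_mem_range {K : Type*} [Field K] [CharZero K] {m : ℕ} (hm : 0 < m) {a : K}
    (ham : a ^ m = 1) {φ : MvPolynomial (Fin 3) K →ₐ[K] MvPolynomial (Fin 3) K}
    (h0 : φ (X 0) = a • X 0) (h1 : φ (X 1) = a • X 0 + a • X 1)
    (h2 : φ (X 2) = -((1 / 2 * a) • X 0) - a • X 1 + a • X 2) {f : MvPolynomial (Fin 3) K}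
    (hf : ∀ n : ℕ, 0 < n → f ^ n ∈ LinearMap.range (LinearMap.id - φ.toLinearMap))
    {s : Fin 3 →₀ ℕ} (hs : s ∈ f.support) : s 2 < s 0 := by
  by_contra! hle
  have hne := exists_coeff_paramHom_ne_zero hs
  set F := paramHom K f with hFdef
  have hF : F ≠ 0 := by
    rintro h
    rw [h] at hne
    exact hne rfl
  obtain ⟨i, d, hg⟩ : ∃ i d : ℤ, F.order = toLex (i, d) :=
    ⟨(ofLex F.order).1, (ofLex F.order).2, rfl⟩
  have hi : i ≤ 0 := by
    have h := HahnSeries.order_le_of_coeff_ne_zero hne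
    rw [hg, biDegree, Prod.Lex.toLex_le_toLex] at h
    omega
  obtain ⟨k, hk, hI⟩ := exists_symmIntegral_pow_ne_zero
    (pow_ne_zero m (HahnSeries.leadingCoeff_ne_zero.mpr hF))
  obtain ⟨u, hu⟩ := hf (m * k) (Nat.mul_pos hm hk)
  apply hI
  rw [← pow_mul, leadingCoeff_pow_eq_coeff, hFdef, ← map_pow, ← hu, ← hFdef, hg, nsmul_toLex,
    LinearMap.sub_apply, map_sub, HahnSeries.coeff_sub, map_sub, sub_eq_zero, eq_comm]
  refine symmIntegral_coeff_paramHom_map ham h0 h1 h2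
    (mul_nonpos_of_nonneg_of_nonpos (by positivity) hi) ?_ u
  exact Dvd.dvd.mul_right (by push_cast; exact dvd_mul_right _ _) d

theorem le_of_mem_support_mul {R : Type*} [CommSemiring R] {f g : MvPolynomial (Fin 3) R} {n k : ℤ}
    (hf : ∀ s ∈ f.support, n ≤ (s 0 : ℤ) - s 2) (hg : ∀ s ∈ g.support, k ≤ (s 0 : ℤ) - s 2) :
    ∀ s ∈ (f * g).support, n + k ≤ (s 0 : ℤ) - s 2 := by
  classical
  intro s hs
  obtain ⟨u, hu, w, hw, rfl⟩ := Finset.mem_add.mp (support_mul f g hs)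
  have := hf u hu
  have := hg w hw
  simp only [Finsupp.add_apply]
  omega

theorem image_of_delta_a_is_MZ
    {K : Type*} [Field K] [CharZero K] (m : ℕ) (hm : 0 < m) (a : K)
    (ham : a ^ m = 1) (ha : ∀ j : ℕ, 0 < j → j < m → a ^ j ≠ 1)
    (φ : MvPolynomial (Fin 3) K →ₐ[K] MvPolynomial (Fin 3) K)
    (hφ1 : φ (X 0) = a • X 0)
    (hφ2 : φ (X 1) = a • X 0 + a • X 1)
    (hφ3 : φ (X 2) = -((1 / 2 * a) • X 0) - a • X 1 + a • X 2)
    (δ : MvPolynomial (Fin 3) K →ₗ[K] MvPolynomial (Fin 3) K)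
    (hδ : δ = LinearMap.id - φ.toLinearMap) :
    IsMZSubspace (LinearMap.range δ) := by
  subst hδ
  intro f g hf
  have hpos (n : ℕ) : ∀ s ∈ (f ^ n).support, (n : ℤ) ≤ (s 0 : ℤ) - s 2 := by
    induction n with
    | zero =>
      intro s hs
      rw [pow_zero, mem_support_iff, coeff_one] at hs
      obtain rfl : s = 0 := by
        by_contra h
        exact hs (if_neg (Ne.symm h))
      simp
    | succ n ih =>
      rw [pow_succ, Nat.cast_succ]
      refine le_of_mem_support_mul ih fun s hs => ?_
      have := lt_of_forall_pow_mem_range hm ham hφ1 hφ2 hφ3 hf hs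
      omega
  refine ⟨g.support.sup (· 2) + 1, fun n hn => ?_⟩
  have hg : ∀ s ∈ g.support, -((g.support.sup (· 2) : ℕ) : ℤ) ≤ (s 0 : ℤ) - s 2 := by
    intro s hs
    have : s 2 ≤ g.support.sup (· 2) := Finset.le_sup (f := fun s : Fin 3 →₀ ℕ => s 2) hs
    omega
  rw [(g * f ^ n).as_sum]
  refine Submodule.sum_mem _ fun s hs => monomial_mem_range_of_lt hφ1 hφ2 hφ3 ?_ _
  have := le_of_mem_support_mul hg (hpos n) s hs
  omega
end
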